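/- arXiv:math/0605464 — 11 statements merged into one kernel-verified Lean document; each statement's English description precedes it below -/
import Mathlib

section
/- Let k₀ be an integer with 1 ≤ k₀ ≤ m−1. The following assertions are equivalent: (1) J(π)∘J(π^⊥) = J(π^⊥)∘J(π) for every k₀-dimensional subspace π of V; (2) J(π)∘J(π^⊥) = J(π^⊥)∘J(π) for every subspace π of V; (3) ρ∘J(π) = J(π)∘ρ for every subspace π of V. (If any of these holds, the model (V,⟪·,·⟫,A) is called Puffini–Videv.) -/
open scoped RealInnerProductSpace

/-- A family whose sums over all `k`-element sets vanish is zero when `1 ≤ k < card ι`. -/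
lemma eq_zero_of_forall_sum_card_eq_zero {ι M : Type*} [Fintype ι] [DecidableEq ι]
    [AddCommGroup M] [Module ℝ M] (f : ι → M) {k : ℕ} (hk : 1 ≤ k) (hk' : k < Fintype.card ι)
    (h : ∀ s : Finset ι, s.card = k → ∑ i ∈ s, f i = 0) (i : ι) : f i = 0 := by
  have heq : ∀ j, f j = f i := by
    intro j
    rcases eq_or_ne j i with rfl | hij
    · rfl
    have hcard : k - 1 ≤ (Finset.univ \ {j, i} : Finset ι).card := by
      rw [Finset.card_sdiff_of_subset (Finset.subset_univ _), Finset.card_pair hij,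
        Finset.card_univ]
      lia
    obtain ⟨t, ht, htc⟩ := Finset.exists_subset_card_eq hcard
    have hj : j ∉ t := fun hmem => by simpa using ht hmem
    have hi : i ∉ t := fun hmem => by simpa using ht hmem
    have h1 := h (insert j t) (by rw [Finset.card_insert_of_notMem hj, htc]; lia)
    have h2 := h (insert i t) (by rw [Finset.card_insert_of_notMem hi, htc]; lia)
    rw [Finset.sum_insert hj] at h1
    rw [Finset.sum_insert hi] at h2
    exact add_right_cancel (h1.trans h2.symm)
  obtain ⟨s, -, hs⟩ := Finset.exists_subset_card_eq (s := (Finset.univ : Finset ι)) (n := k)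
    (by rw [Finset.card_univ]; exact hk'.le)
  have h3 := h s hs
  rw [Finset.sum_congr rfl fun j _ => heq j, Finset.sum_const, hs,
    ← Nat.cast_smul_eq_nsmul ℝ] at h3
  exact (smul_eq_zero.1 h3).resolve_left (by positivity)

section SubspaceSum

variable {V W : Type*} [NormedAddCommGroup V] [InnerProductSpace ℝ V]
  [AddCommGroup W] {J : V → W} {Jp : Submodule ℝ V → W}

lemma eq_sum_of_orthonormalBasis
    (hJp : ∀ (π : Submodule ℝ V)
      (b : OrthonormalBasis (Fin (Module.finrank ℝ π)) ℝ π), Jp π = ∑ i, J (b i : V))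
    {ι : Type*} [Fintype ι] (π : Submodule ℝ V) (b : OrthonormalBasis ι ℝ π) :
    Jp π = ∑ i, J (b i : V) := by
  have hcard : Fintype.card ι = Module.finrank ℝ π :=
    (Module.finrank_eq_card_basis b.toBasis).symm
  let e : ι ≃ Fin (Module.finrank ℝ π) := Fintype.equivFinOfCardEq hcard
  rw [hJp π (b.reindex e), ← e.sum_comp]
  simp

lemma eq_sum_of_orthonormal
    (hJp : ∀ (π : Submodule ℝ V)
      (b : OrthonormalBasis (Fin (Module.finrank ℝ π)) ℝ π), Jp π = ∑ i, J (b i : V))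
    {ι : Type*} [DecidableEq V] {v : ι → V} (hv : Orthonormal ℝ v) (s : Finset ι) :
    Jp (Submodule.span ℝ (s.image v : Set V)) = ∑ i ∈ s, J (v i) := by
  rw [eq_sum_of_orthonormalBasis hJp _ (OrthonormalBasis.span hv s), ← Finset.sum_coe_sort s]
  simp [OrthonormalBasis.span_apply]

lemma add_orthogonal_eq_top [FiniteDimensional ℝ V]
    (hJp : ∀ (π : Submodule ℝ V)
      (b : OrthonormalBasis (Fin (Module.finrank ℝ π)) ℝ π), Jp π = ∑ i, J (b i : V))
    (π : Submodule ℝ V) : Jp π + Jp πᗮ = Jp ⊤ := by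
  classical
  let b := stdOrthonormalBasis ℝ π
  let c := stdOrthonormalBasis ℝ πᗮ
  let v : Fin (Module.finrank ℝ π) ⊕ Fin (Module.finrank ℝ πᗮ) → V :=
    Sum.elim (fun i => (b i : V)) (fun i => (c i : V))
  have hb : Orthonormal ℝ fun i => (b i : V) := b.orthonormal.comp_linearIsometry π.subtypeₗᵢ
  have hc : Orthonormal ℝ fun i => (c i : V) := c.orthonormal.comp_linearIsometry πᗮ.subtypeₗᵢ
  have hv : Orthonormal ℝ v := by
    refine ⟨?_, ?_⟩
    · rintro (i | i)
      · exact hb.1 i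
      · exact hc.1 i
    · rintro (i | i) (j | j) hij
      · exact hb.2 (by simpa using hij)
      · exact (Submodule.mem_orthogonal π _).1 (c j).2 _ (b i).2
      · exact (Submodule.mem_orthogonal' π _).1 (c i).2 _ (b j).2
      · exact hc.2 (by simpa using hij)
  have hspan : Submodule.span ℝ ((Finset.univ.image v : Finset V) : Set V) = ⊤ := by
    refine Submodule.eq_top_of_finrank_eq ?_
    rw [Finset.coe_image, Finset.coe_univ, Set.image_univ,
      finrank_span_eq_card hv.linearIndependent, Fintype.card_sum, Fintype.card_fin,
      Fintype.card_fin, Submodule.finrank_add_finrank_orthogonal]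
  rw [← hspan, eq_sum_of_orthonormal hJp hv, hJp π b, hJp πᗮ c, Fintype.sum_sum_type]
  rfl

end SubspaceSum

/-- Theorem 1.1 (Riemannian version): for an integer k₀ with
1 ≤ k₀ ≤ m−1, the following are equivalent: (1) J(π)∘J(π^⊥) = J(π^⊥)∘J(π) for every
k₀-dimensional subspace π; (2) the same for every subspace π; (3) ρ∘J(π) = J(π)∘ρ
for every subspace π. -/
theorem stmt_2 {V : Type*} [NormedAddCommGroup V] [InnerProductSpace ℝ V]
    [FiniteDimensional ℝ V]
    (hm : 2 ≤ Module.finrank ℝ V)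
    (A : V →ₗ[ℝ] V →ₗ[ℝ] V →ₗ[ℝ] V →ₗ[ℝ] ℝ)
    (hA1 : ∀ v₁ v₂ v₃ v₄ : V, A v₁ v₂ v₃ v₄ = A v₃ v₄ v₁ v₂)
    (hA2 : ∀ v₁ v₂ v₃ v₄ : V, A v₁ v₂ v₃ v₄ = - A v₂ v₁ v₃ v₄)
    (hA3 : ∀ v₁ v₂ v₃ v₄ : V, A v₁ v₂ v₃ v₄ + A v₂ v₃ v₁ v₄ + A v₃ v₁ v₂ v₄ = 0)
    (J : V → V →ₗ[ℝ] V)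
    (hJ : ∀ v x y : V, ⟪J v x, y⟫ = A x v v y)
    (Jp : Submodule ℝ V → V →ₗ[ℝ] V)
    (hJp : ∀ (π : Submodule ℝ V)
        (b : OrthonormalBasis (Fin (Module.finrank ℝ π)) ℝ π),
        Jp π = ∑ i, J (b i : V))
    (k₀ : ℕ) (hk₁ : 1 ≤ k₀) (hk₂ : k₀ ≤ Module.finrank ℝ V - 1) :
    List.TFAE
      [∀ π : Submodule ℝ V, Module.finrank ℝ π = k₀ →
          Jp π ∘ₗ Jp πᗮ = Jp πᗮ ∘ₗ Jp π,
       ∀ π : Submodule ℝ V, Jp π ∘ₗ Jp πᗮ = Jp πᗮ ∘ₗ Jp π,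
       ∀ π : Submodule ℝ V, Jp ⊤ ∘ₗ Jp π = Jp π ∘ₗ Jp ⊤] := by
  classical
  have htop := add_orthogonal_eq_top hJp
  have hiff : ∀ π : Submodule ℝ V, Jp π ∘ₗ Jp πᗮ = Jp πᗮ ∘ₗ Jp π ↔
      Jp ⊤ ∘ₗ Jp π = Jp π ∘ₗ Jp ⊤ := by
    intro π
    rw [← htop π, LinearMap.add_comp, LinearMap.comp_add, add_right_inj, eq_comm]
  tfae_have 2 ↔ 3 := forall_congr' hiff
  tfae_have 2 → 1 := fun h π _ => h π
  tfae_have 1 → 3 := by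
    intro h
    let C : (V →ₗ[ℝ] V) →+ (V →ₗ[ℝ] V) :=
      AddMonoidHom.mulLeft (R := Module.End ℝ V) (Jp ⊤) -
        AddMonoidHom.mulRight (R := Module.End ℝ V) (Jp ⊤)
    have hC : ∀ T : V →ₗ[ℝ] V, C T = 0 ↔ Jp ⊤ ∘ₗ T = T ∘ₗ Jp ⊤ := fun T => sub_eq_zero
    have hbasis : ∀ (b : OrthonormalBasis (Fin (Module.finrank ℝ V)) ℝ V) i,
        C (J (b i)) = 0 := by
      intro b
      refine eq_zero_of_forall_sum_card_eq_zero (fun i => C (J (b i))) hk₁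
        (by rw [Fintype.card_fin]; lia) ?_
      intro s hs
      rw [← map_sum, ← eq_sum_of_orthonormal hJp b.orthonormal s, hC, ← hiff]
      refine h _ ?_
      rw [finrank_span_finset_eq_card, Finset.card_image_of_injective _
        b.orthonormal.linearIndependent.injective, hs]
      have hli : LinearIndepOn ℝ id (Set.range b) :=
        b.orthonormal.linearIndependent.linearIndepOn_id
      exact hli.mono (by simp)
    have hunit : ∀ x : V, ‖x‖ = 1 → C (J x) = 0 := by
      intro x hx
      let i₀ : Fin (Module.finrank ℝ V) := ⟨0, by lia⟩
      have hx' : Orthonormal ℝ (({i₀} : Set (Fin (Module.finrank ℝ V))).domRestrict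
          fun _ => x) :=
        ⟨fun _ => hx, fun i j hij => (hij (Subsingleton.elim i j)).elim⟩
      obtain ⟨b, hb⟩ := hx'.exists_orthonormalBasis_extension_of_card_eq (by simp)
      simpa only [hb i₀ rfl] using hbasis b i₀
    intro π
    rw [← hC, hJp π (stdOrthonormalBasis ℝ π), map_sum]
    exact Finset.sum_eq_zero fun i _ =>
      hunit _ ((stdOrthonormalBasis ℝ π).orthonormal.1 i)
  tfae_finish
end

section
/- Let κ be an integer with 1 ≤ κ ≤ m−1, and suppose that ρ∘J(π) = J(π)∘ρ for every κ-dimensional subspace π of V. Then for any two orthonormal vectors u, w ∈ V one has ρ∘J(u) − J(u)∘ρ = ρ∘J(w) − J(w)∘ρ. -/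
open scoped RealInnerProductSpace

/-- If a map `Jp` on subspaces is the sum of `J` over any orthonormal basis, its value on the span
of a finite orthonormal set is the sum of `J` over that set. -/
theorem apply_span_eq_sum_of_orthonormal {V M : Type*} [NormedAddCommGroup V]
    [InnerProductSpace ℝ V] [AddCommMonoid M] (J : V → M) (Jp : Submodule ℝ V → M)
    (hJp : ∀ (π : Submodule ℝ V)
        (b : OrthonormalBasis (Fin (Module.finrank ℝ π)) ℝ π),
        Jp π = ∑ i, J (b i : V))
    (s : Finset V) (hs : Orthonormal ℝ ((↑) : s → V)) :
    Jp (Submodule.span ℝ (s : Set V)) = ∑ x ∈ s, J x := by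
  classical
  have hspan : Submodule.span ℝ (((Finset.univ : Finset s).image ((↑) : s → V) : Finset V) : Set V)
      = Submodule.span ℝ (s : Set V) := by
    congr 1
    ext x
    simp
  rw [← hspan]
  let b := OrthonormalBasis.span hs Finset.univ
  let e := Fintype.equivFinOfCardEq (Module.finrank_eq_card_basis b.toBasis).symm
  rw [hJp _ (b.reindex e), ← Finset.sum_coe_sort s J,
    Fintype.sum_equiv e.symm _ (fun x => J (b x)) fun i => by
    rw [OrthonormalBasis.reindex_apply]]
  exact Fintype.sum_equiv (Equiv.subtypeUnivEquiv fun x => Finset.mem_univ x) _ _ fun i =>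
    congrArg J (OrthonormalBasis.span_apply hs Finset.univ i)

/-- if ρ∘J(π) = J(π)∘ρ for every κ-dimensional subspace π (1 ≤ κ ≤ m−1),
then for any two orthonormal vectors u, w one has
ρ∘J(u) − J(u)∘ρ = ρ∘J(w) − J(w)∘ρ. -/
theorem stmt_3 {V : Type*} [NormedAddCommGroup V] [InnerProductSpace ℝ V]
    [FiniteDimensional ℝ V]
    (hm : 2 ≤ Module.finrank ℝ V)
    (A : V →ₗ[ℝ] V →ₗ[ℝ] V →ₗ[ℝ] V →ₗ[ℝ] ℝ)
    (hA1 : ∀ v₁ v₂ v₃ v₄ : V, A v₁ v₂ v₃ v₄ = A v₃ v₄ v₁ v₂)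
    (hA2 : ∀ v₁ v₂ v₃ v₄ : V, A v₁ v₂ v₃ v₄ = - A v₂ v₁ v₃ v₄)
    (hA3 : ∀ v₁ v₂ v₃ v₄ : V, A v₁ v₂ v₃ v₄ + A v₂ v₃ v₁ v₄ + A v₃ v₁ v₂ v₄ = 0)
    (J : V → V →ₗ[ℝ] V)
    (hJ : ∀ v x y : V, ⟪J v x, y⟫ = A x v v y)
    (Jp : Submodule ℝ V → V →ₗ[ℝ] V)
    (hJp : ∀ (π : Submodule ℝ V)
        (b : OrthonormalBasis (Fin (Module.finrank ℝ π)) ℝ π),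
        Jp π = ∑ i, J (b i : V))
    (κ : ℕ) (hk₁ : 1 ≤ κ) (hk₂ : κ ≤ Module.finrank ℝ V - 1)
    (hcomm : ∀ π : Submodule ℝ V, Module.finrank ℝ π = κ →
        Jp ⊤ ∘ₗ Jp π = Jp π ∘ₗ Jp ⊤) :
    ∀ u w : V, ⟪u, u⟫ = 1 → ⟪w, w⟫ = 1 → ⟪u, w⟫ = 0 →
      Jp ⊤ ∘ₗ J u - J u ∘ₗ Jp ⊤ = Jp ⊤ ∘ₗ J w - J w ∘ₗ Jp ⊤ := by
  classical
  intro u w hu hw huw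
  have hne : u ≠ w := by
    rintro rfl
    linarith
  have hpair : Orthonormal ℝ ((↑) : ({u, w} : Set V) → V) := by
    rw [orthonormal_subtype_iff_ite]
    rintro x (rfl | rfl) y (rfl | rfl)
    · rwa [if_pos rfl]
    · rwa [if_neg hne]
    · rwa [if_neg hne.symm, real_inner_comm]
    · rwa [if_pos rfl]
  obtain ⟨U, b, hsub, hb⟩ := hpair.exists_orthonormalBasis_extension
  have hU : Orthonormal ℝ ((↑) : U → V) := hb ▸ b.orthonormal
  have hcard : U.card = Module.finrank ℝ V := by
    simpa using (Module.finrank_eq_card_basis b.toBasis).symm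
  have huU : u ∈ U := hsub (by simp)
  have hwU : w ∈ U := hsub (by simp)
  have hle : κ - 1 ≤ ((U.erase u).erase w).card := by
    rw [Finset.card_erase_of_mem (Finset.mem_erase.2 ⟨hne.symm, hwU⟩),
      Finset.card_erase_of_mem huU]
    omega
  obtain ⟨T, hT, hTcard⟩ := Finset.exists_subset_card_eq hle
  have huT : u ∉ T := fun h => by simpa using hT h
  have hwT : w ∉ T := fun h => by simpa using hT h
  have hTU : T ⊆ U := hT.trans ((Finset.erase_subset _ _).trans (Finset.erase_subset _ _))
  have key : ∀ z ∈ U, z ∉ T →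
      Jp ⊤ ∘ₗ (J z + ∑ x ∈ T, J x) = (J z + ∑ x ∈ T, J x) ∘ₗ Jp ⊤ := by
    intro z hz hzT
    have hs : Orthonormal ℝ ((↑) : ↥(insert z T : Finset V) → V) :=
      hU.comp (fun x : ↥(insert z T : Finset V) =>
        (⟨x, Finset.insert_subset hz hTU x.2⟩ : U)) fun _ _ h =>
          Subtype.ext (congrArg (fun t : U => (t : V)) h)
    have hfin : Module.finrank ℝ (Submodule.span ℝ ((insert z T : Finset V) : Set V)) = κ := by
      rw [finrank_span_finset_eq_card hs.linearIndependent, Finset.card_insert_of_notMem hzT]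
      omega
    have h := hcomm _ hfin
    rwa [apply_span_eq_sum_of_orthonormal J Jp hJp _ hs, Finset.sum_insert hzT] at h
  have h₁ := key u huU huT
  have h₂ := key w hwU hwT
  simp only [LinearMap.comp_add, LinearMap.add_comp] at h₁ h₂
  rw [add_comm (J u ∘ₗ Jp ⊤), ← sub_eq_sub_iff_add_eq_add] at h₁
  rw [add_comm (J w ∘ₗ Jp ⊤), ← sub_eq_sub_iff_add_eq_add] at h₂
  exact h₁.trans h₂.symm
end

section
/- Let κ be an integer with 1 ≤ κ ≤ m−1, and suppose that ρ∘J(π) = J(π)∘ρ for every κ-dimensional subspace π of V. Then ρ∘J(v) = J(v)∘ρ for every vector v ∈ V. -/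
open scoped RealInnerProductSpace

/-- A family whose sums over all `k`-element sets vanish, for some `0 < k < card ι`, is zero. -/
lemma eq_zero_of_forall_card_sum_eq_zero {ι W : Type*} [Fintype ι] [DecidableEq ι]
    [AddCommGroup W] [Module ℝ W] {f : ι → W} {k : ℕ} (hk : 1 ≤ k) (hk' : k < Fintype.card ι)
    (h : ∀ s : Finset ι, s.card = k → ∑ i ∈ s, f i = 0) (i : ι) : f i = 0 := by
  have heq : ∀ j, f j = f i := by
    intro j
    by_cases hij : j = i
    · rw [hij]
    have hc : k - 1 ≤ ((Finset.univ.erase i).erase j).card := by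
      rw [Finset.card_erase_of_mem (by simp [hij]), Finset.card_erase_of_mem (by simp),
        Finset.card_univ]
      omega
    obtain ⟨t, ht, htc⟩ := Finset.exists_subset_card_eq hc
    have hi : i ∉ t := fun hi ↦ by simpa using ht hi
    have hj : j ∉ t := fun hj ↦ by simpa using ht hj
    have h₁ := h (insert i t) (by rw [Finset.card_insert_of_notMem hi]; omega)
    have h₂ := h (insert j t) (by rw [Finset.card_insert_of_notMem hj]; omega)
    rw [Finset.sum_insert hi] at h₁
    rw [Finset.sum_insert hj] at h₂
    exact add_right_cancel (h₂.trans h₁.symm)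
  obtain ⟨s, -, hs⟩ := Finset.exists_subset_card_eq (s := (Finset.univ : Finset ι)) (n := k)
    (by rw [Finset.card_univ]; exact hk'.le)
  have hsum := h s hs
  rw [Finset.sum_congr rfl fun j _ ↦ heq j, Finset.sum_const, hs,
    ← Nat.cast_smul_eq_nsmul ℝ] at hsum
  exact (smul_eq_zero.mp hsum).resolve_left (by exact_mod_cast (by omega : k ≠ 0))

/-- Every unit vector is a member of an orthonormal basis. -/
lemma exists_orthonormalBasis_apply_eq {V : Type*} [NormedAddCommGroup V] [InnerProductSpace ℝ V]
    [FiniteDimensional ℝ V] {u : V} (hu : ‖u‖ = 1) :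
    ∃ (b : OrthonormalBasis (Fin (Module.finrank ℝ V)) ℝ V) (i : _), b i = u := by
  have hpos : 0 < Module.finrank ℝ V :=
    Module.finrank_pos_iff_exists_ne_zero.mpr ⟨u, by rintro rfl; simp at hu⟩
  obtain ⟨b, hb⟩ := Orthonormal.exists_orthonormalBasis_extension_of_card_eq
    (𝕜 := ℝ) (E := V) (ι := Fin (Module.finrank ℝ V)) (by simp)
    (v := fun _ ↦ u) (s := {⟨0, hpos⟩})
    ⟨fun _ ↦ hu, fun i j hij ↦ (hij (Subsingleton.elim i j)).elim⟩
  exact ⟨b, ⟨0, hpos⟩, hb _ rfl⟩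

/-- if ρ∘J(π) = J(π)∘ρ for every κ-dimensional subspace π (1 ≤ κ ≤ m−1),
then ρ∘J(v) = J(v)∘ρ for every v ∈ V. -/
theorem stmt_4 {V : Type*} [NormedAddCommGroup V] [InnerProductSpace ℝ V]
    [FiniteDimensional ℝ V]
    (hm : 2 ≤ Module.finrank ℝ V)
    (A : V →ₗ[ℝ] V →ₗ[ℝ] V →ₗ[ℝ] V →ₗ[ℝ] ℝ)
    (hA1 : ∀ v₁ v₂ v₃ v₄ : V, A v₁ v₂ v₃ v₄ = A v₃ v₄ v₁ v₂)
    (hA2 : ∀ v₁ v₂ v₃ v₄ : V, A v₁ v₂ v₃ v₄ = - A v₂ v₁ v₃ v₄)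
    (hA3 : ∀ v₁ v₂ v₃ v₄ : V, A v₁ v₂ v₃ v₄ + A v₂ v₃ v₁ v₄ + A v₃ v₁ v₂ v₄ = 0)
    (J : V → V →ₗ[ℝ] V)
    (hJ : ∀ v x y : V, ⟪J v x, y⟫ = A x v v y)
    (Jp : Submodule ℝ V → V →ₗ[ℝ] V)
    (hJp : ∀ (π : Submodule ℝ V)
        (b : OrthonormalBasis (Fin (Module.finrank ℝ π)) ℝ π),
        Jp π = ∑ i, J (b i : V))
    (κ : ℕ) (hk₁ : 1 ≤ κ) (hk₂ : κ ≤ Module.finrank ℝ V - 1)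
    (hcomm : ∀ π : Submodule ℝ V, Module.finrank ℝ π = κ →
        Jp ⊤ ∘ₗ Jp π = Jp π ∘ₗ Jp ⊤) :
    ∀ v : V, Jp ⊤ ∘ₗ J v = J v ∘ₗ Jp ⊤ := by
  classical
  have hspan : ∀ (b : OrthonormalBasis (Fin (Module.finrank ℝ V)) ℝ V) (s : Finset (Fin _)),
      s.card = κ → Jp ⊤ ∘ₗ (∑ i ∈ s, J (b i)) = (∑ i ∈ s, J (b i)) ∘ₗ Jp ⊤ := by
    intro b s hs
    set c := OrthonormalBasis.span b.orthonormal s with hc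
    have hfin := Module.finrank_eq_card_basis c.toBasis
    have hcard : Fintype.card s = κ := by simpa using hs
    let e : s ≃ Fin _ := (Fintype.equivFin s).trans (finCongr hfin.symm)
    have hsum : Jp (Submodule.span ℝ (s.image b : Set V)) = ∑ i ∈ s, J (b i) := by
      rw [hJp _ (c.reindex e), ← e.sum_comp, ← Finset.sum_coe_sort s]
      refine Finset.sum_congr rfl fun i _ ↦ ?_
      rw [OrthonormalBasis.reindex_apply, Equiv.symm_apply_apply, hc,
        OrthonormalBasis.span_apply]
    rw [← hsum]
    exact hcomm _ (hfin.trans hcard)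
  have hunit : ∀ u : V, ‖u‖ = 1 → Jp ⊤ ∘ₗ J u = J u ∘ₗ Jp ⊤ := by
    intro u hu
    obtain ⟨b, i, rfl⟩ := exists_orthonormalBasis_apply_eq hu
    refine sub_eq_zero.mp (eq_zero_of_forall_card_sum_eq_zero
      (f := fun i ↦ Jp ⊤ ∘ₗ J (b i) - J (b i) ∘ₗ Jp ⊤) hk₁ (by simp; omega) ?_ i)
    intro s hs
    rw [Finset.sum_sub_distrib, sub_eq_zero]
    simpa only [LinearMap.ext_iff, LinearMap.comp_apply, LinearMap.sum_apply, map_sum]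
      using hspan b s hs
  have hsmul : ∀ (a : ℝ) (v : V), J (a • v) = (a * a) • J v := by
    intro a v
    ext x
    refine ext_inner_right ℝ fun y ↦ ?_
    simp [hJ, inner_smul_left, mul_assoc]
  intro v
  by_cases hv : v = 0
  · have h0 := hsmul 0 v
    simp only [zero_smul, mul_zero] at h0
    simp [hv, h0]
  have hvu : v = ‖v‖ • (‖v‖⁻¹ • v) := by
    rw [smul_smul, mul_inv_cancel₀ (norm_ne_zero_iff.mpr hv), one_smul]
  rw [hvu, hsmul, LinearMap.comp_smul, LinearMap.smul_comp,
    hunit _ (by rw [norm_smul, norm_inv, norm_norm, inv_mul_cancel₀ (norm_ne_zero_iff.mpr hv)])]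
end

section
/- If ρ∘J(v) = J(v)∘ρ for every vector v ∈ V, then ρ∘J(π) = J(π)∘ρ for every subspace π of V, and consequently J(π)∘J(π^⊥) = J(π^⊥)∘J(π) for every subspace π of V. -/
open scoped RealInnerProductSpace

/-- An orthonormal basis of `K` and one of `Kᗮ` together form an orthonormal basis of the
ambient space, here regarded as `⊤`. -/
theorem exists_orthonormalBasis_top_of_orthogonal {V : Type*} [NormedAddCommGroup V]
    [InnerProductSpace ℝ V] [FiniteDimensional ℝ V] (K : Submodule ℝ V)
    {ι κ : Type*} [Fintype ι] [Fintype κ]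
    (b : OrthonormalBasis ι ℝ K) (c : OrthonormalBasis κ ℝ Kᗮ) :
    ∃ d : OrthonormalBasis (ι ⊕ κ) ℝ (⊤ : Submodule ℝ V),
      (∀ i, (d (Sum.inl i) : V) = b i) ∧ ∀ j, (d (Sum.inr j) : V) = c j := by
  refine ⟨((b.prod c).map K.orthogonalDecomposition.symm).map
    (LinearIsometryEquiv.ofTop V ⊤ rfl).symm, fun i => ?_, fun j => ?_⟩ <;>
  simp [Submodule.orthogonalDecomposition_symm_apply]

/-- if ρ∘J(v) = J(v)∘ρ for every vector v, then ρ∘J(π) = J(π)∘ρ for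
every subspace π, and consequently J(π)∘J(π^⊥) = J(π^⊥)∘J(π) for every subspace π. -/
theorem stmt_5 {V : Type*} [NormedAddCommGroup V] [InnerProductSpace ℝ V]
    [FiniteDimensional ℝ V]
    (A : V →ₗ[ℝ] V →ₗ[ℝ] V →ₗ[ℝ] V →ₗ[ℝ] ℝ)
    (hA1 : ∀ v₁ v₂ v₃ v₄ : V, A v₁ v₂ v₃ v₄ = A v₃ v₄ v₁ v₂)
    (hA2 : ∀ v₁ v₂ v₃ v₄ : V, A v₁ v₂ v₃ v₄ = - A v₂ v₁ v₃ v₄)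
    (hA3 : ∀ v₁ v₂ v₃ v₄ : V, A v₁ v₂ v₃ v₄ + A v₂ v₃ v₁ v₄ + A v₃ v₁ v₂ v₄ = 0)
    (J : V → V →ₗ[ℝ] V)
    (hJ : ∀ v x y : V, ⟪J v x, y⟫ = A x v v y)
    (Jp : Submodule ℝ V → V →ₗ[ℝ] V)
    (hJp : ∀ (π : Submodule ℝ V)
        (b : OrthonormalBasis (Fin (Module.finrank ℝ π)) ℝ π),
        Jp π = ∑ i, J (b i : V))
    (hcomm : ∀ v : V, Jp ⊤ ∘ₗ J v = J v ∘ₗ Jp ⊤) :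
    (∀ π : Submodule ℝ V, Jp ⊤ ∘ₗ Jp π = Jp π ∘ₗ Jp ⊤) ∧
    (∀ π : Submodule ℝ V, Jp π ∘ₗ Jp πᗮ = Jp πᗮ ∘ₗ Jp π) := by
  have ric_comm : ∀ π : Submodule ℝ V, Jp ⊤ ∘ₗ Jp π = Jp π ∘ₗ Jp ⊤ := fun π => by
    rw [hJp π (stdOrthonormalBasis ℝ π)]
    exact Commute.sum_right (R := Module.End ℝ V) _ _ _ fun i _ => hcomm _
  have ric_split : ∀ π : Submodule ℝ V, Jp ⊤ = Jp π + Jp πᗮ := fun π => by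
    obtain ⟨d, hd₁, hd₂⟩ := exists_orthonormalBasis_top_of_orthogonal π
      (stdOrthonormalBasis ℝ π) (stdOrthonormalBasis ℝ πᗮ)
    let e := Fintype.equivFinOfCardEq (Module.finrank_eq_card_basis d.toBasis).symm
    rw [hJp ⊤ (d.reindex e), hJp π (stdOrthonormalBasis ℝ π), hJp πᗮ (stdOrthonormalBasis ℝ πᗮ),
      ← e.sum_comp, Fintype.sum_sum_type]
    simp only [OrthonormalBasis.reindex_apply, Equiv.symm_apply_apply, hd₁, hd₂]
  refine ⟨ric_comm, fun π => ?_⟩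
  have h := ric_comm π
  rw [ric_split π, LinearMap.add_comp, LinearMap.comp_add] at h
  exact (add_left_cancel h).symm
end

section
/- Suppose V = V₁ ⊕ V₂ is an orthogonal direct sum decomposition which decomposes A, i.e. A(x₁,x₂,x₃,x₄) = 0 whenever each xᵢ lies in V₁ ∪ V₂ but the four arguments do not all lie in V₁ nor all lie in V₂, and suppose there are real constants c₁, c₂ with ρ(x) = c₁x for all x ∈ V₁ and ρ(x) = c₂x for all x ∈ V₂. Then J(π)∘J(π^⊥) = J(π^⊥)∘J(π) for every subspace π of V (an orthogonal direct sum of Einstein models is Puffini–Videv). -/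
open scoped RealInnerProductSpace

/-- An orthonormal basis of a subspace, viewed in the ambient space, spans that subspace. -/
theorem OrthonormalBasis.span_range_coe {V ι : Type*} [NormedAddCommGroup V]
    [InnerProductSpace ℝ V] [Fintype ι] {U : Submodule ℝ V} (b : OrthonormalBasis ι ℝ U) :
    Submodule.span ℝ (Set.range fun i => (b i : V)) = U := by
  have h := congrArg (Submodule.map U.subtype) b.toBasis.span_eq
  rw [Submodule.map_span, ← Set.range_comp, Submodule.map_subtype_top] at h
  simpa [Function.comp_def] using h

/-- Orthonormal bases of `U` and `Uᗮ` combine to an orthonormal basis of the whole space. -/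
theorem Submodule.exists_orthonormalBasis_sumElim {V ι κ : Type*} [NormedAddCommGroup V]
    [InnerProductSpace ℝ V] [FiniteDimensional ℝ V] [Fintype ι] [Fintype κ] (U : Submodule ℝ V)
    (b : OrthonormalBasis ι ℝ U) (b' : OrthonormalBasis κ ℝ Uᗮ) :
    ∃ e : OrthonormalBasis (ι ⊕ κ) ℝ V,
      ⇑e = Sum.elim (fun i => (b i : V)) (fun i => (b' i : V)) := by
  classical
  refine ⟨OrthonormalBasis.mk (v := Sum.elim (fun i => (b i : V)) (fun i => (b' i : V)))
    ?_ ?_, OrthonormalBasis.coe_mk _ _⟩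
  · rw [orthonormal_iff_ite]
    rintro (i | i) (j | j)
    · simpa using orthonormal_iff_ite.1 b.orthonormal i j
    · simpa using U.inner_right_of_mem_orthogonal (b i).2 (b' j).2
    · simpa using U.inner_left_of_mem_orthogonal (b j).2 (b' i).2
    · simpa using orthonormal_iff_ite.1 b'.orthonormal i j
  · rw [Set.Sum.elim_range, Submodule.span_union, b.span_range_coe, b'.span_range_coe,
      Submodule.sup_orthogonal_of_hasOrthogonalProjection]

/-- A vector orthogonal to one summand of an orthogonal decomposition lies in the other. -/
theorem Submodule.mem_of_sup_eq_top_of_inner_eq_zero {V : Type*} [NormedAddCommGroup V]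
    [InnerProductSpace ℝ V] {U W : Submodule ℝ V} (h_orth : ∀ x ∈ U, ∀ y ∈ W, ⟪x, y⟫ = 0)
    (h_span : U ⊔ W = ⊤) {z : V} (hz : ∀ y ∈ W, ⟪z, y⟫ = 0) : z ∈ U := by
  obtain ⟨a, ha, b, hb, rfl⟩ := Submodule.mem_sup.1 (h_span ▸ Submodule.mem_top : z ∈ U ⊔ W)
  have h := hz b hb
  rw [inner_add_left, h_orth a ha b hb, zero_add, inner_self_eq_zero] at h
  simpa [h] using ha

/-- an orthogonal direct sum of Einstein models is Puffini–Videv. -/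
theorem stmt_7 {V : Type*} [NormedAddCommGroup V] [InnerProductSpace ℝ V]
    [FiniteDimensional ℝ V]
    (A : V →ₗ[ℝ] V →ₗ[ℝ] V →ₗ[ℝ] V →ₗ[ℝ] ℝ)
    (hA1 : ∀ v₁ v₂ v₃ v₄ : V, A v₁ v₂ v₃ v₄ = A v₃ v₄ v₁ v₂)
    (hA2 : ∀ v₁ v₂ v₃ v₄ : V, A v₁ v₂ v₃ v₄ = - A v₂ v₁ v₃ v₄)
    (hA3 : ∀ v₁ v₂ v₃ v₄ : V, A v₁ v₂ v₃ v₄ + A v₂ v₃ v₁ v₄ + A v₃ v₁ v₂ v₄ = 0)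
    (J : V → V →ₗ[ℝ] V)
    (hJ : ∀ v x y : V, ⟪J v x, y⟫ = A x v v y)
    (Jp : Submodule ℝ V → V →ₗ[ℝ] V)
    (hJp : ∀ (π : Submodule ℝ V)
        (b : OrthonormalBasis (Fin (Module.finrank ℝ π)) ℝ π),
        Jp π = ∑ i, J (b i : V))
    (V₁ V₂ : Submodule ℝ V)
    (h_orth : ∀ x ∈ V₁, ∀ y ∈ V₂, ⟪x, y⟫ = 0)
    (h_span : V₁ ⊔ V₂ = ⊤)
    (h_dec : ∀ x₁ x₂ x₃ x₄ : V,
        (x₁ ∈ V₁ ∨ x₁ ∈ V₂) → (x₂ ∈ V₁ ∨ x₂ ∈ V₂) →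
        (x₃ ∈ V₁ ∨ x₃ ∈ V₂) → (x₄ ∈ V₁ ∨ x₄ ∈ V₂) →
        ¬ (x₁ ∈ V₁ ∧ x₂ ∈ V₁ ∧ x₃ ∈ V₁ ∧ x₄ ∈ V₁) →
        ¬ (x₁ ∈ V₂ ∧ x₂ ∈ V₂ ∧ x₃ ∈ V₂ ∧ x₄ ∈ V₂) →
        A x₁ x₂ x₃ x₄ = 0)
    (c₁ c₂ : ℝ)
    (h₁ : ∀ x ∈ V₁, Jp ⊤ x = c₁ • x)
    (h₂ : ∀ x ∈ V₂, Jp ⊤ x = c₂ • x) :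
    ∀ π : Submodule ℝ V, Jp π ∘ₗ Jp πᗮ = Jp πᗮ ∘ₗ Jp π := by
  have apply_eq_zero (v : V) {x y : V} (hx : x ∈ V₁) (hy : y ∈ V₂) :
      A x v v y = 0 ∧ A y v v x = 0 := by
    by_cases hy₁ : y ∈ V₁
    · have : y = 0 := inner_self_eq_zero.1 (h_orth y hy₁ y hy)
      simp [this]
    by_cases hx₂ : x ∈ V₂
    · have : x = 0 := inner_self_eq_zero.1 (h_orth x hx x hx₂)
      simp [this]
    obtain ⟨a, ha, b, hb, rfl⟩ :=
      Submodule.mem_sup.1 (h_span ▸ Submodule.mem_top : v ∈ V₁ ⊔ V₂)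
    have mixed (p q : V) (hp : p ∈ V₁ ∨ p ∈ V₂) (hq : q ∈ V₁ ∨ q ∈ V₂) :
        A x p q y = 0 ∧ A y p q x = 0 :=
      ⟨h_dec x p q y (.inl hx) hp hq (.inr hy) (by tauto) (by tauto),
        h_dec y p q x (.inr hy) hp hq (.inl hx) (by tauto) (by tauto)⟩
    simp [mixed a a (.inl ha) (.inl ha), mixed a b (.inl ha) (.inr hb),
      mixed b a (.inr hb) (.inl ha), mixed b b (.inr hb) (.inr hb)]
  have map_mem₁ (v : V) {x : V} (hx : x ∈ V₁) : J v x ∈ V₁ :=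
    Submodule.mem_of_sup_eq_top_of_inner_eq_zero h_orth h_span fun y hy => by
      rw [hJ, (apply_eq_zero v hx hy).1]
  have map_mem₂ (v : V) {y : V} (hy : y ∈ V₂) : J v y ∈ V₂ :=
    Submodule.mem_of_sup_eq_top_of_inner_eq_zero
      (fun y hy x hx => by rw [real_inner_comm, h_orth x hx y hy])
      (sup_comm V₁ V₂ ▸ h_span) fun x hx => by rw [hJ, (apply_eq_zero v hx hy).2]
  intro π
  let b := stdOrthonormalBasis ℝ π
  let b' := stdOrthonormalBasis ℝ πᗮ
  have ricci_eq : Jp ⊤ = Jp π + Jp πᗮ := by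
    obtain ⟨e, he⟩ := π.exists_orthonormalBasis_sumElim b b'
    let f := e.map (LinearIsometryEquiv.ofTop V (⊤ : Submodule ℝ V) rfl).symm
    have card_eq : Fintype.card (Fin (Module.finrank ℝ π) ⊕ Fin (Module.finrank ℝ πᗮ)) =
        Fintype.card (Fin (Module.finrank ℝ (⊤ : Submodule ℝ V))) := by
      rw [← Module.finrank_eq_card_basis f.toBasis, Fintype.card_fin]
    let σ := Fintype.equivOfCardEq card_eq
    rw [hJp ⊤ (f.reindex σ), hJp π b, hJp πᗮ b', ← σ.sum_comp, Fintype.sum_sum_type]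
    simp [f, he]
  have commute_ricci : Jp π ∘ₗ Jp ⊤ = Jp ⊤ ∘ₗ Jp π := by
    ext x
    obtain ⟨y, hy, z, hz, rfl⟩ :=
      Submodule.mem_sup.1 (h_span ▸ Submodule.mem_top : x ∈ V₁ ⊔ V₂)
    have hy' : Jp π y ∈ V₁ := by
      rw [hJp π b, LinearMap.sum_apply]
      exact Submodule.sum_mem _ fun i _ => map_mem₁ _ hy
    have hz' : Jp π z ∈ V₂ := by
      rw [hJp π b, LinearMap.sum_apply]
      exact Submodule.sum_mem _ fun i _ => map_mem₂ _ hz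
    simp only [LinearMap.comp_apply, map_add, h₁ y hy, h₂ z hz, map_smul, h₁ _ hy', h₂ _ hz']
  rw [ricci_eq, LinearMap.comp_add, LinearMap.add_comp] at commute_ricci
  exact add_left_cancel commute_ricci
end

section
/- Suppose ρ∘J(v) = J(v)∘ρ for every v ∈ V. Let x₁, x₂, x₃, x₄ be eigenvectors of ρ with eigenvalues λ₁, λ₂, λ₃, λ₄ respectively. If λ₁ ≠ λ₄, then A(x₁,x₂,x₃,x₄) = −A(x₁,x₃,x₂,x₄). -/
open scoped RealInnerProductSpace

/-- if ρ commutes with all Jacobi operators and x₁,…,x₄ are eigenvectors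
of ρ with eigenvalues μ₁,…,μ₄, then μ₁ ≠ μ₄ implies A(x₁,x₂,x₃,x₄) = −A(x₁,x₃,x₂,x₄). -/
theorem stmt_8 {V : Type*} [NormedAddCommGroup V] [InnerProductSpace ℝ V]
    [FiniteDimensional ℝ V]
    (A : V →ₗ[ℝ] V →ₗ[ℝ] V →ₗ[ℝ] V →ₗ[ℝ] ℝ)
    (hA1 : ∀ v₁ v₂ v₃ v₄ : V, A v₁ v₂ v₃ v₄ = A v₃ v₄ v₁ v₂)
    (hA2 : ∀ v₁ v₂ v₃ v₄ : V, A v₁ v₂ v₃ v₄ = - A v₂ v₁ v₃ v₄)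
    (hA3 : ∀ v₁ v₂ v₃ v₄ : V, A v₁ v₂ v₃ v₄ + A v₂ v₃ v₁ v₄ + A v₃ v₁ v₂ v₄ = 0)
    (J : V → V →ₗ[ℝ] V)
    (hJ : ∀ v x y : V, ⟪J v x, y⟫ = A x v v y)
    (ρ : V →ₗ[ℝ] V)
    (hρ : ∀ b : OrthonormalBasis (Fin (Module.finrank ℝ V)) ℝ V, ρ = ∑ i, J (b i))
    (hcomm : ∀ v : V, ρ ∘ₗ J v = J v ∘ₗ ρ)
    (x₁ x₂ x₃ x₄ : V) (μ₁ μ₂ μ₃ μ₄ : ℝ)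
    (hx₁ : x₁ ≠ 0) (hx₂ : x₂ ≠ 0) (hx₃ : x₃ ≠ 0) (hx₄ : x₄ ≠ 0)
    (he₁ : ρ x₁ = μ₁ • x₁) (he₂ : ρ x₂ = μ₂ • x₂)
    (he₃ : ρ x₃ = μ₃ • x₃) (he₄ : ρ x₄ = μ₄ • x₄)
    (hne : μ₁ ≠ μ₄) :
    A x₁ x₂ x₃ x₄ = - A x₁ x₃ x₂ x₄ := by
  have hJs : ∀ v, (J v).IsSymmetric := fun v x y => by
    rw [real_inner_comm (J v y) x, hJ, hJ]
    linarith [hA1 x v v y, hA2 v y x v, hA1 y v x v, hA2 x v y v, hA1 v x y v]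
  have hρs : ρ.IsSymmetric := fun x y => by
    rw [hρ (stdOrthonormalBasis ℝ V), LinearMap.sum_apply, LinearMap.sum_apply, sum_inner,
      inner_sum]
    exact Finset.sum_congr rfl fun i _ => hJs _ x y
  have hzero : ∀ v, A x₁ v v x₄ = 0 := fun v => by
    have h := hρs (J v x₁) x₄
    rw [show ρ (J v x₁) = J v (ρ x₁) from LinearMap.congr_fun (hcomm v) x₁, he₁, he₄, map_smul,
      real_inner_smul_left, real_inner_smul_right, hJ] at h
    exact (mul_eq_mul_right_iff.mp h).resolve_left hne
  have h := hzero (x₂ + x₃)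
  simp only [map_add, LinearMap.add_apply, hzero] at h
  linarith
end

section
/- Suppose ρ∘J(v) = J(v)∘ρ for every v ∈ V. Let x₁, x₂, x₃, x₄ be eigenvectors of ρ with eigenvalues λ₁, λ₂, λ₃, λ₄ respectively. If λ₁ ≠ λ₄ and λ₂ ≠ λ₄, then A(x₁,x₂,x₃,x₄) = 0. -/
open scoped RealInnerProductSpace

/-- if ρ commutes with all Jacobi operators and x₁,…,x₄ are eigenvectors
of ρ with eigenvalues μ₁,…,μ₄, then μ₁ ≠ μ₄ and μ₂ ≠ μ₄ imply A(x₁,x₂,x₃,x₄) = 0. -/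
theorem stmt_9 {V : Type*} [NormedAddCommGroup V] [InnerProductSpace ℝ V]
    [FiniteDimensional ℝ V]
    (A : V →ₗ[ℝ] V →ₗ[ℝ] V →ₗ[ℝ] V →ₗ[ℝ] ℝ)
    (hA1 : ∀ v₁ v₂ v₃ v₄ : V, A v₁ v₂ v₃ v₄ = A v₃ v₄ v₁ v₂)
    (hA2 : ∀ v₁ v₂ v₃ v₄ : V, A v₁ v₂ v₃ v₄ = - A v₂ v₁ v₃ v₄)
    (hA3 : ∀ v₁ v₂ v₃ v₄ : V, A v₁ v₂ v₃ v₄ + A v₂ v₃ v₁ v₄ + A v₃ v₁ v₂ v₄ = 0)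
    (J : V → V →ₗ[ℝ] V)
    (hJ : ∀ v x y : V, ⟪J v x, y⟫ = A x v v y)
    (ρ : V →ₗ[ℝ] V)
    (hρ : ∀ b : OrthonormalBasis (Fin (Module.finrank ℝ V)) ℝ V, ρ = ∑ i, J (b i))
    (hcomm : ∀ v : V, ρ ∘ₗ J v = J v ∘ₗ ρ)
    (x₁ x₂ x₃ x₄ : V) (μ₁ μ₂ μ₃ μ₄ : ℝ)
    (hx₁ : x₁ ≠ 0) (hx₂ : x₂ ≠ 0) (hx₃ : x₃ ≠ 0) (hx₄ : x₄ ≠ 0)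
    (he₁ : ρ x₁ = μ₁ • x₁) (he₂ : ρ x₂ = μ₂ • x₂)
    (he₃ : ρ x₃ = μ₃ • x₃) (he₄ : ρ x₄ = μ₄ • x₄)
    (hne₁ : μ₁ ≠ μ₄) (hne₂ : μ₂ ≠ μ₄) :
    A x₁ x₂ x₃ x₄ = 0 := by
  have hJs : ∀ v x y : V, ⟪J v x, y⟫ = ⟪x, J v y⟫ := fun v x y => by
    rw [real_inner_comm (J v y) x, hJ, hJ]
    linarith [hA1 x v v y, hA2 v y x v, hA1 y v x v, hA2 x v y v,
      hA1 v x y v]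
  have hρs : ∀ x y : V, ⟪ρ x, y⟫ = ⟪x, ρ y⟫ := fun x y => by
    rw [hρ (stdOrthonormalBasis ℝ V)]
    simp only [LinearMap.sum_apply, sum_inner, inner_sum, hJs]
  have hzero : ∀ (x y : V) (a b : ℝ), ρ x = a • x → ρ y = b • y → a ≠ b →
      ∀ v, A x v v y = 0 := fun x y a b hx hy hab v => by
    have h : ρ (J v x) = J v (ρ x) := LinearMap.congr_fun (hcomm v) x
    have h' := hρs (J v x) y
    rw [h, hx, hy, map_smul, real_inner_smul_left, real_inner_smul_right, hJ] at h'
    have h'' : (a - b) * A x v v y = 0 := by linarith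
    exact (mul_eq_zero.mp h'').resolve_left (sub_ne_zero.mpr hab)
  have hpolar : ∀ (x y : V), (∀ v, A x v v y = 0) →
      ∀ u w, A x u w y + A x w u y = 0 := fun x y h u w => by
    have huw := h (u + w)
    simp only [map_add, LinearMap.add_apply] at huw
    linarith [h u, h w]
  linarith [hpolar x₁ x₄ (hzero x₁ x₄ μ₁ μ₄ he₁ he₄ hne₁) x₂ x₃,
    hpolar x₂ x₄ (hzero x₂ x₄ μ₂ μ₄ he₂ he₄ hne₂) x₁ x₃,
    hA3 x₁ x₂ x₃ x₄, hA2 x₁ x₂ x₃ x₄, hA2 x₁ x₃ x₂ x₄]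
end

section
/- Suppose ρ∘J(v) = J(v)∘ρ for every v ∈ V. Let x₁, x₂, x₃, x₄ be eigenvectors of ρ with eigenvalues λ₁, λ₂, λ₃, λ₄ respectively. If A(x₁,x₂,x₃,x₄) ≠ 0, then λ₁ = λ₂ = λ₃ = λ₄. -/
open scoped RealInnerProductSpace

/-- If an operator `ρ` is symmetric with respect to every Jacobi form of `A`, then for
eigenvectors `x`, `y` with different eigenvalues the polarized Jacobi form vanishes. -/
lemma polarized_jacobi_eq_zero {V : Type*} [AddCommGroup V] [Module ℝ V]
    (A : V →ₗ[ℝ] V →ₗ[ℝ] V →ₗ[ℝ] V →ₗ[ℝ] ℝ) (ρ : V →ₗ[ℝ] V)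
    (h : ∀ v x y : V, A (ρ x) v v y = A x v v (ρ y))
    {x y : V} {μ ν : ℝ} (hx : ρ x = μ • x) (hy : ρ y = ν • y) (hne : μ ≠ ν) (u v : V) :
    A x u v y + A x v u y = 0 := by
  have key : ∀ w : V, A x w w y = 0 := fun w => by
    have hw := h w x y
    simp only [hx, hy, map_smul, LinearMap.smul_apply, smul_eq_mul] at hw
    have : (μ - ν) * A x w w y = 0 := by linarith
    exact (mul_eq_zero.mp this).resolve_left (sub_ne_zero.mpr hne)
  have huv := key (u + v)
  simp only [map_add, LinearMap.add_apply, key u, key v] at huv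
  linarith

/-- if ρ commutes with all Jacobi operators and x₁,…,x₄ are eigenvectors
of ρ with eigenvalues μ₁,…,μ₄, then A(x₁,x₂,x₃,x₄) ≠ 0 implies μ₁ = μ₂ = μ₃ = μ₄. -/
theorem stmt_10 {V : Type*} [NormedAddCommGroup V] [InnerProductSpace ℝ V]
    [FiniteDimensional ℝ V]
    (A : V →ₗ[ℝ] V →ₗ[ℝ] V →ₗ[ℝ] V →ₗ[ℝ] ℝ)
    (hA1 : ∀ v₁ v₂ v₃ v₄ : V, A v₁ v₂ v₃ v₄ = A v₃ v₄ v₁ v₂)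
    (hA2 : ∀ v₁ v₂ v₃ v₄ : V, A v₁ v₂ v₃ v₄ = - A v₂ v₁ v₃ v₄)
    (hA3 : ∀ v₁ v₂ v₃ v₄ : V, A v₁ v₂ v₃ v₄ + A v₂ v₃ v₁ v₄ + A v₃ v₁ v₂ v₄ = 0)
    (J : V → V →ₗ[ℝ] V)
    (hJ : ∀ v x y : V, ⟪J v x, y⟫ = A x v v y)
    (ρ : V →ₗ[ℝ] V)
    (hρ : ∀ b : OrthonormalBasis (Fin (Module.finrank ℝ V)) ℝ V, ρ = ∑ i, J (b i))
    (hcomm : ∀ v : V, ρ ∘ₗ J v = J v ∘ₗ ρ)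
    (x₁ x₂ x₃ x₄ : V) (μ₁ μ₂ μ₃ μ₄ : ℝ)
    (hx₁ : x₁ ≠ 0) (hx₂ : x₂ ≠ 0) (hx₃ : x₃ ≠ 0) (hx₄ : x₄ ≠ 0)
    (he₁ : ρ x₁ = μ₁ • x₁) (he₂ : ρ x₂ = μ₂ • x₂)
    (he₃ : ρ x₃ = μ₃ • x₃) (he₄ : ρ x₄ = μ₄ • x₄)
    (hA0 : A x₁ x₂ x₃ x₄ ≠ 0) :
    μ₁ = μ₂ ∧ μ₂ = μ₃ ∧ μ₃ = μ₄ := by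
  have hA4 : ∀ v₁ v₂ v₃ v₄ : V, A v₁ v₂ v₃ v₄ = - A v₁ v₂ v₄ v₃ := fun a b c d => by
    rw [hA1 a b c d, hA2 c d a b, hA1 d c a b]
  have hJsymm : ∀ v x y : V, ⟪J v x, y⟫ = ⟪x, J v y⟫ := fun v x y => by
    rw [real_inner_comm, real_inner_comm, hJ, real_inner_comm, hJ, hA1, hA2, hA4, neg_neg]
  have hρsymm : ∀ x y : V, ⟪ρ x, y⟫ = ⟪x, ρ y⟫ := fun x y => by
    rw [hρ (stdOrthonormalBasis ℝ V)]
    simp only [LinearMap.sum_apply, sum_inner, inner_sum, hJsymm]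
  have hsymm : ∀ v x y : V, A (ρ x) v v y = A x v v (ρ y) := fun v x y => by
    rw [← hJ, ← hJ, ← hρsymm, ← LinearMap.comp_apply, ← hcomm, LinearMap.comp_apply]
  have pair₁₂ : μ₁ ≠ μ₂ → A x₁ x₃ x₂ x₄ + A x₁ x₄ x₂ x₃ = 0 := fun hne => by
    have := polarized_jacobi_eq_zero A ρ hsymm he₁ he₂ hne x₃ x₄
    linarith [hA4 x₁ x₃ x₂ x₄, hA4 x₁ x₄ x₂ x₃]
  have pair₃₄ : μ₃ ≠ μ₄ → A x₁ x₃ x₂ x₄ + A x₁ x₄ x₂ x₃ = 0 := fun hne => by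
    have := polarized_jacobi_eq_zero A ρ hsymm he₃ he₄ hne x₁ x₂
    linarith [hA2 x₁ x₃ x₂ x₄, hA1 x₁ x₄ x₂ x₃, hA2 x₃ x₂ x₁ x₄, hA2 x₃ x₁ x₂ x₄]
  have pair₁₃ : μ₁ ≠ μ₃ → A x₁ x₂ x₃ x₄ = A x₁ x₄ x₂ x₃ := fun hne => by
    have := polarized_jacobi_eq_zero A ρ hsymm he₁ he₃ hne x₂ x₄
    linarith [hA4 x₁ x₂ x₃ x₄]
  have pair₂₄ : μ₂ ≠ μ₄ → A x₁ x₂ x₃ x₄ = A x₁ x₄ x₂ x₃ := fun hne => by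
    have := polarized_jacobi_eq_zero A ρ hsymm he₂ he₄ hne x₁ x₃
    linarith [hA2 x₁ x₂ x₃ x₄, hA1 x₁ x₄ x₂ x₃]
  have pair₁₄ : μ₁ ≠ μ₄ → A x₁ x₂ x₃ x₄ + A x₁ x₃ x₂ x₄ = 0 := fun hne =>
    polarized_jacobi_eq_zero A ρ hsymm he₁ he₄ hne x₂ x₃
  have pair₂₃ : μ₂ ≠ μ₃ → A x₁ x₂ x₃ x₄ + A x₁ x₃ x₂ x₄ = 0 := fun hne => by
    have := polarized_jacobi_eq_zero A ρ hsymm he₂ he₃ hne x₁ x₄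
    linarith [hA2 x₁ x₂ x₃ x₄, hA4 x₂ x₁ x₄ x₃, hA1 x₁ x₃ x₂ x₄, hA4 x₂ x₄ x₁ x₃]
  have bianchi : A x₁ x₂ x₃ x₄ - A x₁ x₃ x₂ x₄ + A x₁ x₄ x₂ x₃ = 0 := by
    linarith [hA3 x₁ x₂ x₃ x₄, hA1 x₁ x₄ x₂ x₃, hA2 x₁ x₃ x₂ x₄]
  grind
end

section
/- The following are equivalent: (a) J(π)∘J(π^⊥) = J(π^⊥)∘J(π) for every subspace π of V (the model is Puffini–Videv); (b) whenever x₁, x₂, x₃, x₄ are eigenvectors of ρ with eigenvalues λ₁, λ₂, λ₃, λ₄ that are not all equal, A(x₁,x₂,x₃,x₄) = 0. (Since ρ is self-adjoint, (b) expresses that the model decomposes as the orthogonal direct sum, over the eigenspaces of ρ, of Einstein models; this is Theorem 1.2.) -/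
open scoped RealInnerProductSpace

section CurvatureTensor

variable {V : Type*} [NormedAddCommGroup V] [InnerProductSpace ℝ V]

/-- If `A x v v y = 0` whenever `x` and `y` are eigenvectors of `R` with distinct eigenvalues, then
the curvature tensor `A` vanishes on quadruples of eigenvectors whose outer entries have distinct
eigenvalues. -/
theorem curvature_eq_zero_of_outer_ne
    {A : V →ₗ[ℝ] V →ₗ[ℝ] V →ₗ[ℝ] V →ₗ[ℝ] ℝ}
    (hA1 : ∀ v₁ v₂ v₃ v₄ : V, A v₁ v₂ v₃ v₄ = A v₃ v₄ v₁ v₂)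
    (hA2 : ∀ v₁ v₂ v₃ v₄ : V, A v₁ v₂ v₃ v₄ = - A v₂ v₁ v₃ v₄)
    (hA3 : ∀ v₁ v₂ v₃ v₄ : V, A v₁ v₂ v₃ v₄ + A v₂ v₃ v₁ v₄ + A v₃ v₁ v₂ v₄ = 0)
    {R : V →ₗ[ℝ] V}
    (h : ∀ (x y : V) (μ ν : ℝ), R x = μ • x → R y = ν • y → μ ≠ ν → ∀ v, A x v v y = 0)
    {x₁ x₂ x₃ x₄ : V} {μ₁ μ₂ μ₃ μ₄ : ℝ}
    (h₁ : R x₁ = μ₁ • x₁) (h₂ : R x₂ = μ₂ • x₂) (h₃ : R x₃ = μ₃ • x₃) (h₄ : R x₄ = μ₄ • x₄)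
    (hne : μ₁ ≠ μ₄) : A x₁ x₂ x₃ x₄ = 0 := by
  have polar : ∀ (x y : V) (μ ν : ℝ), R x = μ • x → R y = ν • y → μ ≠ ν →
      ∀ v w, A x v w y + A x w v y = 0 := by
    intro x y μ ν hx hy hμν v w
    have hvw := h x y μ ν hx hy hμν (v + w)
    have hv := h x y μ ν hx hy hμν v
    have hw := h x y μ ν hx hy hμν w
    simp only [map_add, LinearMap.add_apply] at hvw
    linarith
  have key : ∀ (a b c d : V) (α β δ : ℝ), R a = α • a → R b = β • b → R d = δ • d →
      α ≠ δ → β ≠ δ → A a b c d = 0 := by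
    intro a b c d α β δ ha hb hd hαδ hβδ
    have e₁ := polar a d α δ ha hd hαδ b c
    have e₂ := polar b d β δ hb hd hβδ a c
    linarith [hA3 a b c d, hA2 a b c d, hA2 c a b d]
  by_cases h₂₄ : μ₂ = μ₄
  · by_cases h₃₄ : μ₃ = μ₄
    · have e := key x₄ x₃ x₂ x₁ μ₄ μ₃ μ₁ h₄ h₃ h₁ hne.symm (by rw [h₃₄]; exact hne.symm)
      linarith [hA1 x₁ x₂ x₃ x₄, hA2 x₃ x₄ x₁ x₂, hA1 x₄ x₃ x₁ x₂, hA2 x₁ x₂ x₄ x₃,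
        hA1 x₂ x₁ x₄ x₃]
    · have e := key x₁ x₃ x₂ x₄ μ₁ μ₃ μ₄ h₁ h₃ h₄ hne h₃₄
      linarith [polar x₁ x₄ μ₁ μ₄ h₁ h₄ hne x₂ x₃]
  · exact key x₁ x₂ x₃ x₄ μ₁ μ₂ μ₄ h₁ h₂ h₄ hne h₂₄

/-- If `A x v v y = 0` whenever `x` and `y` are eigenvectors of `R` with distinct eigenvalues, then
the curvature tensor `A` vanishes on quadruples of eigenvectors whose eigenvalues are not all
equal. -/
theorem curvature_eq_zero_of_not_all_eq
    {A : V →ₗ[ℝ] V →ₗ[ℝ] V →ₗ[ℝ] V →ₗ[ℝ] ℝ}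
    (hA1 : ∀ v₁ v₂ v₃ v₄ : V, A v₁ v₂ v₃ v₄ = A v₃ v₄ v₁ v₂)
    (hA2 : ∀ v₁ v₂ v₃ v₄ : V, A v₁ v₂ v₃ v₄ = - A v₂ v₁ v₃ v₄)
    (hA3 : ∀ v₁ v₂ v₃ v₄ : V, A v₁ v₂ v₃ v₄ + A v₂ v₃ v₁ v₄ + A v₃ v₁ v₂ v₄ = 0)
    {R : V →ₗ[ℝ] V}
    (h : ∀ (x y : V) (μ ν : ℝ), R x = μ • x → R y = ν • y → μ ≠ ν → ∀ v, A x v v y = 0)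
    {x₁ x₂ x₃ x₄ : V} {μ₁ μ₂ μ₃ μ₄ : ℝ}
    (h₁ : R x₁ = μ₁ • x₁) (h₂ : R x₂ = μ₂ • x₂) (h₃ : R x₃ = μ₃ • x₃) (h₄ : R x₄ = μ₄ • x₄)
    (hne : ¬ (μ₁ = μ₂ ∧ μ₂ = μ₃ ∧ μ₃ = μ₄)) : A x₁ x₂ x₃ x₄ = 0 := by
  by_cases h₁₄ : μ₁ = μ₄
  · by_cases h₂₄ : μ₂ = μ₄
    · have h₁₃ : μ₁ ≠ μ₃ := by grind
      have e := curvature_eq_zero_of_outer_ne hA1 hA2 hA3 h h₁ h₂ h₄ h₃ h₁₃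
      linarith [hA1 x₁ x₂ x₃ x₄, hA2 x₃ x₄ x₁ x₂, hA1 x₄ x₃ x₁ x₂]
    · have e := curvature_eq_zero_of_outer_ne hA1 hA2 hA3 h h₂ h₁ h₃ h₄ h₂₄
      linarith [hA2 x₁ x₂ x₃ x₄]
  · exact curvature_eq_zero_of_outer_ne hA1 hA2 hA3 h h₁ h₂ h₃ h₄ h₁₄

variable {J : V → V →ₗ[ℝ] V}

theorem jacobi_isSymmetric
    {A : V →ₗ[ℝ] V →ₗ[ℝ] V →ₗ[ℝ] V →ₗ[ℝ] ℝ}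
    (hA1 : ∀ v₁ v₂ v₃ v₄ : V, A v₁ v₂ v₃ v₄ = A v₃ v₄ v₁ v₂)
    (hA2 : ∀ v₁ v₂ v₃ v₄ : V, A v₁ v₂ v₃ v₄ = - A v₂ v₁ v₃ v₄)
    (hJ : ∀ v x y : V, ⟪J v x, y⟫ = A x v v y) (v : V) : (J v).IsSymmetric := by
  intro x y
  rw [real_inner_comm, real_inner_comm, hJ, real_inner_comm, hJ]
  linarith [hA1 x v v y, hA2 v y x v, hA1 y v x v, hA2 x v y v, hA1 v x y v]

theorem jacobi_smul {A : V →ₗ[ℝ] V →ₗ[ℝ] V →ₗ[ℝ] V →ₗ[ℝ] ℝ}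
    (hJ : ∀ v x y : V, ⟪J v x, y⟫ = A x v v y) (c : ℝ) (v : V) :
    J (c • v) = c ^ 2 • J v := by
  ext x
  refine ext_inner_right ℝ fun y => ?_
  simp only [LinearMap.smul_apply, inner_smul_left, hJ, map_smul, smul_eq_mul, conj_trivial]
  ring

variable {Jp : Submodule ℝ V → V →ₗ[ℝ] V}

theorem higherJacobi_span_singleton {A : V →ₗ[ℝ] V →ₗ[ℝ] V →ₗ[ℝ] V →ₗ[ℝ] ℝ}
    (hJ : ∀ v x y : V, ⟪J v x, y⟫ = A x v v y)
    (hJp : ∀ (π : Submodule ℝ V) (b : OrthonormalBasis (Fin (Module.finrank ℝ π)) ℝ π),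
      Jp π = ∑ i, J (b i : V)) {v : V} (hv : v ≠ 0) :
    ∃ c : ℝ, c ≠ 0 ∧ Jp (Submodule.span ℝ {v}) = c • J v := by
  let b := stdOrthonormalBasis ℝ (Submodule.span ℝ {v})
  choose c hc using fun i => Submodule.mem_span_singleton.mp (b i).2
  refine ⟨∑ i, c i ^ 2, ?_, ?_⟩
  · have hpos : ∀ i, 0 < c i ^ 2 := fun i => by
      refine sq_pos_of_ne_zero fun h0 => b.orthonormal.ne_zero i ?_
      ext
      simp [← hc i, h0]
    have : Nonempty (Fin (Module.finrank ℝ (Submodule.span ℝ {v}))) := by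
      rw [finrank_span_singleton hv]
      infer_instance
    exact (Finset.sum_pos (fun i _ => hpos i) Finset.univ_nonempty).ne'
  · rw [hJp _ b, Finset.sum_smul]
    exact Finset.sum_congr rfl fun i _ => by rw [← hc i, jacobi_smul hJ]

variable [FiniteDimensional ℝ V]

theorem higherJacobi_add_orthogonal
    (hJp : ∀ (π : Submodule ℝ V) (b : OrthonormalBasis (Fin (Module.finrank ℝ π)) ℝ π),
      Jp π = ∑ i, J (b i : V)) (π : Submodule ℝ V) :
    Jp π + Jp πᗮ = Jp ⊤ := by
  let b := stdOrthonormalBasis ℝ π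
  let c := stdOrthonormalBasis ℝ πᗮ
  let d : OrthonormalBasis _ ℝ V := (b.prod c).map π.orthogonalDecomposition.symm
  let e : Fin (Module.finrank ℝ π) ⊕ Fin (Module.finrank ℝ πᗮ) ≃
      Fin (Module.finrank ℝ (⊤ : Submodule ℝ V)) :=
    Fintype.equivOfCardEq (by simp [Submodule.finrank_add_finrank_orthogonal])
  rw [hJp π b, hJp πᗮ c,
    hJp ⊤ ((d.map (LinearIsometryEquiv.ofTop V ⊤ rfl).symm).reindex e),
    ← e.sum_comp, Fintype.sum_sum_type]
  simp [d]

/-- The model is Puffini–Videv iff every Jacobi operator commutes with the Ricci operator. -/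
theorem puffiniVidev_iff_commute_ricci {A : V →ₗ[ℝ] V →ₗ[ℝ] V →ₗ[ℝ] V →ₗ[ℝ] ℝ}
    (hJ : ∀ v x y : V, ⟪J v x, y⟫ = A x v v y)
    (hJp : ∀ (π : Submodule ℝ V) (b : OrthonormalBasis (Fin (Module.finrank ℝ π)) ℝ π),
      Jp π = ∑ i, J (b i : V)) :
    (∀ π : Submodule ℝ V, Jp π ∘ₗ Jp πᗮ = Jp πᗮ ∘ₗ Jp π) ↔ ∀ v, Commute (J v) (Jp ⊤) := by
  have hperp (π : Submodule ℝ V) :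
      Jp π ∘ₗ Jp πᗮ = Jp πᗮ ∘ₗ Jp π ↔ Commute (Jp π) (Jp ⊤) := by
    rw [← higherJacobi_add_orthogonal hJp π]
    constructor
    · intro h
      exact (Commute.refl _).add_right h
    · intro h
      have e := (h.sub_right (Commute.refl _)).eq
      rwa [add_sub_cancel_left] at e
  simp only [hperp]
  constructor
  · intro h v
    rcases eq_or_ne v 0 with rfl | hv
    · have := jacobi_smul hJ 0 0
      rw [smul_zero] at this
      rw [this]
      simp
    · obtain ⟨c, hc, hcv⟩ := higherJacobi_span_singleton hJ hJp hv
      have hcomm := (h (Submodule.span ℝ {v})).smul_left c⁻¹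
      rwa [hcv, smul_smul, inv_mul_cancel₀ hc, one_smul] at hcomm
  · intro h π
    rw [hJp π (stdOrthonormalBasis ℝ π)]
    exact Commute.sum_left _ _ _ fun i _ => h _

end CurvatureTensor

/-- Theorem 1.2: a Riemannian 0-model is Puffini–Videv iff the curvature
tensor vanishes on quadruples of eigenvectors of ρ whose eigenvalues are not all equal. -/
theorem stmt_11 {V : Type*} [NormedAddCommGroup V] [InnerProductSpace ℝ V]
    [FiniteDimensional ℝ V]
    (A : V →ₗ[ℝ] V →ₗ[ℝ] V →ₗ[ℝ] V →ₗ[ℝ] ℝ)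
    (hA1 : ∀ v₁ v₂ v₃ v₄ : V, A v₁ v₂ v₃ v₄ = A v₃ v₄ v₁ v₂)
    (hA2 : ∀ v₁ v₂ v₃ v₄ : V, A v₁ v₂ v₃ v₄ = - A v₂ v₁ v₃ v₄)
    (hA3 : ∀ v₁ v₂ v₃ v₄ : V, A v₁ v₂ v₃ v₄ + A v₂ v₃ v₁ v₄ + A v₃ v₁ v₂ v₄ = 0)
    (J : V → V →ₗ[ℝ] V)
    (hJ : ∀ v x y : V, ⟪J v x, y⟫ = A x v v y)
    (Jp : Submodule ℝ V → V →ₗ[ℝ] V)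
    (hJp : ∀ (π : Submodule ℝ V)
        (b : OrthonormalBasis (Fin (Module.finrank ℝ π)) ℝ π),
        Jp π = ∑ i, J (b i : V)) :
    (∀ π : Submodule ℝ V, Jp π ∘ₗ Jp πᗮ = Jp πᗮ ∘ₗ Jp π) ↔
    (∀ (x₁ x₂ x₃ x₄ : V) (μ₁ μ₂ μ₃ μ₄ : ℝ),
      x₁ ≠ 0 → x₂ ≠ 0 → x₃ ≠ 0 → x₄ ≠ 0 →
      Jp ⊤ x₁ = μ₁ • x₁ → Jp ⊤ x₂ = μ₂ • x₂ →
      Jp ⊤ x₃ = μ₃ • x₃ → Jp ⊤ x₄ = μ₄ • x₄ →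
      ¬ (μ₁ = μ₂ ∧ μ₂ = μ₃ ∧ μ₃ = μ₄) →
      A x₁ x₂ x₃ x₄ = 0) := by
  have hsymm : (Jp ⊤).IsSymmetric := by
    rw [hJp ⊤ (stdOrthonormalBasis ℝ _)]
    intro x y
    simp only [LinearMap.sum_apply, sum_inner, inner_sum]
    exact Finset.sum_congr rfl fun i _ => jacobi_isSymmetric hA1 hA2 hJ _ x y
  rw [puffiniVidev_iff_commute_ricci hJ hJp]
  constructor
  · intro h x₁ x₂ x₃ x₄ μ₁ μ₂ μ₃ μ₄ _ _ _ _ h₁ h₂ h₃ h₄ hne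
    refine curvature_eq_zero_of_not_all_eq hA1 hA2 hA3 ?_ h₁ h₂ h₃ h₄ hne
    intro x y μ ν hx hy hμν v
    have hcomm : J v (Jp ⊤ x) = Jp ⊤ (J v x) := LinearMap.congr_fun (h v).eq x
    have e : μ * A x v v y = ν * A x v v y := by
      rw [← hJ, ← real_inner_smul_left, ← map_smul, ← hx, hcomm, hsymm, hy,
        real_inner_smul_right]
    exact (mul_eq_mul_right_iff.mp e).resolve_left hμν
  · intro h v
    let b := hsymm.eigenvectorBasis rfl
    let ev := hsymm.eigenvalues rfl
    have hb (i) : Jp ⊤ (b i) = ev i • b i := hsymm.apply_eigenvectorBasis rfl i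
    have hzero (i j) (hij : ev i ≠ ev j) : A (b i) v v (b j) = 0 := by
      have hbasis (k l) : A (b i) (b k) (b l) (b j) = 0 :=
        h _ _ _ _ _ _ _ _ (b.orthonormal.ne_zero i) (b.orthonormal.ne_zero k)
          (b.orthonormal.ne_zero l) (b.orthonormal.ne_zero j) (hb i) (hb k) (hb l) (hb j)
          (by grind)
      rw [← b.sum_repr v]
      simp [hbasis]
    refine b.toBasis.ext fun i => InnerProductSpace.ext_inner_right_basis b.toBasis fun j => ?_
    simp only [OrthonormalBasis.coe_toBasis, Module.End.mul_apply]
    rw [hsymm, hb, hb, map_smul, real_inner_smul_left, real_inner_smul_right, hJ]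
    by_cases hij : ev i = ev j
    · rw [hij]
    · rw [hzero i j hij, mul_zero, mul_zero]
end

section
/- Let (p,q) be the signature of B, so V has a basis {u₁,…,u_m} with B(uᵢ,u_j) = 0 for i ≠ j, B(uᵢ,uᵢ) = 1 for exactly p indices and B(uᵢ,uᵢ) = −1 for exactly q indices. Let (r₀,s₀) be admissible: 0 ≤ r₀ ≤ p, 0 ≤ s₀ ≤ q, and 1 ≤ r₀+s₀ ≤ m−1. If J(π)∘J(π^⊥) = J(π^⊥)∘J(π) for every nondegenerate subspace π of signature (r₀,s₀) (i.e., every π admitting a basis {e₁,…,e_{r₀+s₀}} with B(eᵢ,e_j) = εᵢδᵢⱼ, where exactly r₀ of the εᵢ equal 1 and exactly s₀ equal −1), then ρ∘J(v) = J(v)∘ρ for every v ∈ V, and consequently ρ∘J(π) = J(π)∘ρ and J(π)∘J(π^⊥) = J(π^⊥)∘J(π) for every nondegenerate subspace π of V. -/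
section PseudoOrthonormal

variable {V : Type*} [AddCommGroup V] [Module ℝ V] {ι κ : Type*}

/-- `u` is a pseudo-orthonormal family for `B` with signs `ζ`. -/
def IsPseudoOrthonormal [DecidableEq ι] (B : V →ₗ[ℝ] V →ₗ[ℝ] ℝ) (ζ : ι → ℝ) (u : ι → V) : Prop :=
  ∀ i j, B (u i) (u j) = if i = j then ζ i else 0

/-- The (hyperbolic or Euclidean) rotation of the vectors `u i`, `u j` in the plane they span. -/
def planeRotation [DecidableEq ι] (ζ : ι → ℝ) (u : ι → V) (i j : ι) (a b : ℝ) (k : ι) : V :=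
  if k = i then a • u i + b • u j
  else if k = j then (-(ζ i * ζ j * b)) • u i + a • u j
  else u k

lemma mul_self_eq_one_of_sign {ζ : ι → ℝ} (hζ : ∀ i, ζ i = 1 ∨ ζ i = -1) (i : ι) :
    ζ i * ζ i = 1 := by
  rcases hζ i with h | h <;> simp [h]

lemma IsPseudoOrthonormal.planeRotation [DecidableEq ι] {B : V →ₗ[ℝ] V →ₗ[ℝ] ℝ}
    {ζ : ι → ℝ} {u : ι → V} (hu : IsPseudoOrthonormal B ζ u)
    (hζ : ∀ i, ζ i = 1 ∨ ζ i = -1) {i j : ι} (hij : i ≠ j)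
    {a b : ℝ} (hab : a * a + ζ i * ζ j * (b * b) = 1) :
    IsPseudoOrthonormal B ζ (planeRotation ζ u i j a b) := by
  have hi := mul_self_eq_one_of_sign hζ i
  have hj := mul_self_eq_one_of_sign hζ j
  have hji := hij.symm
  intro k l
  unfold _root_.planeRotation
  by_cases hki : k = i
  · subst hki
    by_cases hlk : l = k
    · subst hlk
      simp [hu _ _, hij, hji]
      linear_combination ζ l * hab - ζ j * (b * b) * hi
    · by_cases hlj : l = j
      · subst hlj
        simp [hu _ _, hij, hji]
        linear_combination (-a * b * ζ l) * hi
      · simp [hu _ _, hlk, hlj, Ne.symm hlk, Ne.symm hlj]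
  · by_cases hkj : k = j
    · subst hkj
      by_cases hli : l = i
      · subst hli
        simp [hu _ _, hij, hji]
        linear_combination (-a * b * ζ k) * hi
      · by_cases hlk : l = k
        · subst hlk
          simp [hu _ _, hij, hji]
          linear_combination ζ l * hab + (b * b * ζ i * (ζ l * ζ l)) * hi
        · simp [hu _ _, hlk, hli, hji, Ne.symm hlk, Ne.symm hli]
    · by_cases hli : l = i
      · subst hli
        simp [hu _ _, hki, hkj]
      · by_cases hlj : l = j
        · subst hlj
          simp [hu _ _, hki, hkj, hji]
        · simp [hu _ _, hki, hkj, hli, hlj]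

lemma exists_rotation_coefficients {ζ : ι → ℝ} (hζ : ∀ i, ζ i = 1 ∨ ζ i = -1) (i j : ι) :
    ∃ a b : ℝ, a ≠ 0 ∧ b ≠ 0 ∧ a * a + ζ i * ζ j * (b * b) = 1 := by
  have h : ζ i * ζ j = 1 ∨ ζ i * ζ j = -1 := by
    rcases hζ i with h | h <;> rcases hζ j with h' | h' <;> simp [h, h']
  rcases h with h | h
  · exact ⟨3 / 5, 4 / 5, by norm_num, by norm_num, by rw [h]; norm_num⟩
  · exact ⟨5 / 4, 3 / 4, by norm_num, by norm_num, by rw [h]; norm_num⟩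

/-- If the partial trace of `b` over a proper nonempty set of indices vanishes for all
pseudo-orthonormal families with signs `ζ`, then so does the diagonal of `b` on such families. -/
lemma apply_self_eq_zero_of_sum_eq_zero [DecidableEq ι]
    {B b : V →ₗ[ℝ] V →ₗ[ℝ] ℝ} {ζ : ι → ℝ}
    (hζ : ∀ i, ζ i = 1 ∨ ζ i = -1) {S : Finset ι} (hS : S.Nonempty) (hS' : ∃ j, j ∉ S)
    (h : ∀ u, IsPseudoOrthonormal B ζ u → ∑ i ∈ S, ζ i * b (u i) (u i) = 0)
    {u : ι → V} (hu : IsPseudoOrthonormal B ζ u) (i : ι) : b (u i) (u i) = 0 := by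
  have key : ∀ i ∈ S, ∀ j ∉ S, ζ i * b (u i) (u i) = ζ j * b (u j) (u j) := by
    intro i hiS j hjS
    have hij : i ≠ j := fun e => hjS (e ▸ hiS)
    have invariant : ∀ a c : ℝ, a * a + ζ i * ζ j * (c * c) = 1 →
        b (a • u i + c • u j) (a • u i + c • u j) = b (u i) (u i) := by
      intro a c hac
      have h1 := h _ (hu.planeRotation hζ hij hac)
      have h2 := h u hu
      rw [← Finset.add_sum_erase _ _ hiS] at h1 h2
      have h3 : ∑ k ∈ S.erase i, ζ k * b (planeRotation ζ u i j a c k)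
          (planeRotation ζ u i j a c k) = ∑ k ∈ S.erase i, ζ k * b (u k) (u k) := by
        refine Finset.sum_congr rfl fun k hk => ?_
        have hki := Finset.ne_of_mem_erase hk
        have hkj : k ≠ j := fun e => hjS (e ▸ Finset.mem_of_mem_erase hk)
        simp [planeRotation, hki, hkj]
      rw [h3] at h1
      simp only [planeRotation, if_true] at h1
      have hi := mul_self_eq_one_of_sign hζ i
      have h4 : ζ i * b (a • u i + c • u j) (a • u i + c • u j) = ζ i * b (u i) (u i) := by
        linarith
      exact mul_left_cancel₀ (left_ne_zero_of_mul_eq_one hi) h4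
    obtain ⟨a, c, -, hc, hac⟩ := exists_rotation_coefficients hζ i j
    have h1 := invariant a c hac
    have h2 := invariant a (-c) (by linear_combination hac)
    simp at h1 h2
    have hi := mul_self_eq_one_of_sign hζ i
    have h3 : (c * c) * b (u j) (u j) = (c * c) * (ζ i * ζ j * b (u i) (u i)) := by
      linear_combination (h1 + h2) / 2 - b (u i) (u i) * hac
    have h4 := mul_left_cancel₀ (mul_ne_zero hc hc) h3
    rw [h4]
    linear_combination (-ζ i * b (u i) (u i)) * mul_self_eq_one_of_sign hζ j
  have outside : ∀ j ∉ S, ζ j * b (u j) (u j) = 0 := by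
    intro j hj
    have h1 := h u hu
    rw [Finset.sum_congr rfl fun i hi => key i hi j hj, Finset.sum_const, nsmul_eq_mul] at h1
    exact (mul_eq_zero.mp h1).resolve_left (by exact_mod_cast hS.card_pos.ne')
  have all : ζ i * b (u i) (u i) = 0 := by
    by_cases hi : i ∈ S
    · obtain ⟨j, hj⟩ := hS'
      rw [key i hi j hj, outside j hj]
    · exact outside i hi
  exact (mul_eq_zero.mp all).resolve_left
    (left_ne_zero_of_mul_eq_one (mul_self_eq_one_of_sign hζ i))

lemma alternating_of_sum_eq_zero [DecidableEq ι]
    {B b : V →ₗ[ℝ] V →ₗ[ℝ] ℝ} {ζ : ι → ℝ}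
    (hζ : ∀ i, ζ i = 1 ∨ ζ i = -1) {S : Finset ι} (hS : S.Nonempty) (hS' : ∃ j, j ∉ S)
    (h : ∀ u, IsPseudoOrthonormal B ζ u → ∑ i ∈ S, ζ i * b (u i) (u i) = 0)
    {u : ι → V} (hu : IsPseudoOrthonormal B ζ u) (hspan : Submodule.span ℝ (Set.range u) = ⊤)
    (v : V) : b v v = 0 := by
  have hdiag := fun {w : ι → V} (hw : IsPseudoOrthonormal B ζ w) =>
    apply_self_eq_zero_of_sum_eq_zero hζ hS hS' h hw
  have hskew : b + b.flip = 0 := by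
    refine LinearMap.ext_on_range hspan fun i => LinearMap.ext_on_range hspan fun j => ?_
    by_cases hij : i = j
    · subst hij
      simp [hdiag hu i]
    · obtain ⟨a, c, ha, hc, hac⟩ := exists_rotation_coefficients hζ i j
      have h1 := hdiag (hu.planeRotation hζ hij hac) i
      simp [planeRotation, hdiag hu i, hdiag hu j] at h1
      have h2 : (a * c) * (b (u i) (u j) + b (u j) (u i)) = 0 := by linear_combination h1
      simpa using (mul_eq_zero.mp h2).resolve_left (mul_ne_zero ha hc)
  have := LinearMap.congr_fun₂ hskew v v
  simp at this
  linarith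

lemma IsPseudoOrthonormal.linearIndependent [DecidableEq ι] [Fintype ι]
    {B : V →ₗ[ℝ] V →ₗ[ℝ] ℝ} {ζ : ι → ℝ} {u : ι → V} (hu : IsPseudoOrthonormal B ζ u)
    (hζ : ∀ i, ζ i = 1 ∨ ζ i = -1) :
    LinearIndependent ℝ u := by
  rw [Fintype.linearIndependent_iff]
  intro g hg i
  have h := congrArg (fun x => B x (u i)) hg
  simp [map_sum, hu _ _] at h
  rcases hζ i with h' | h' <;> simpa [h'] using h

lemma IsPseudoOrthonormal.eq_sum_of_mem_span [DecidableEq ι] [Fintype ι]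
    {B : V →ₗ[ℝ] V →ₗ[ℝ] ℝ} {ζ : ι → ℝ} {u : ι → V} (hu : IsPseudoOrthonormal B ζ u)
    (hζ : ∀ i, ζ i = 1 ∨ ζ i = -1) {v : V}
    (hv : v ∈ Submodule.span ℝ (Set.range u)) : v = ∑ i, (ζ i * B v (u i)) • u i := by
  obtain ⟨c, rfl⟩ := (Submodule.mem_span_range_iff_exists_fun ℝ).mp hv
  refine Finset.sum_congr rfl fun i _ => ?_
  congr 1
  simp [map_sum, hu _ _]
  linear_combination (-c i) * mul_self_eq_one_of_sign hζ i

/-- The trace of a bilinear form does not depend on the pseudo-orthonormal basis. -/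
lemma sum_sign_mul_apply_self_eq [Fintype ι] [Fintype κ] {B : V →ₗ[ℝ] V →ₗ[ℝ] ℝ}
    (hB : ∀ x y, B x y = B y x) {ζ : ι → ℝ} {u : ι → V} {η : κ → ℝ} {w : κ → V}
    (hu : ∀ v, v = ∑ i, (ζ i * B v (u i)) • u i) (hw : ∀ v, v = ∑ j, (η j * B v (w j)) • w j)
    (b : V →ₗ[ℝ] V →ₗ[ℝ] ℝ) :
    ∑ i, ζ i * b (u i) (u i) = ∑ j, η j * b (w j) (w j) := by
  have h1 : ∀ i, ζ i * b (u i) (u i) = ∑ j, ζ i * η j * B (u i) (w j) * b (u i) (w j) := by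
    intro i
    conv_lhs => enter [2, 2]; rw [hw (u i)]
    simp [map_sum, Finset.mul_sum, mul_assoc]
  have h2 : ∀ j, η j * b (w j) (w j) = ∑ i, ζ i * η j * B (u i) (w j) * b (u i) (w j) := by
    intro j
    conv_lhs => enter [2, 1, 2]; rw [hu (w j)]
    simp only [map_sum, map_smul, LinearMap.sum_apply, LinearMap.smul_apply, smul_eq_mul,
      Finset.mul_sum]
    refine Finset.sum_congr rfl fun i _ => ?_
    rw [hB (w j) (u i)]
    ring
  simp_rw [h1, h2]
  exact Finset.sum_comm

/-- Pseudo-orthonormal bases of `π` and `π^⊥` together expand every vector. -/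
lemma eq_sum_elim_of_span_eq_orthogonal [DecidableEq ι] [Fintype ι] [Fintype κ] [DecidableEq κ]
    {B : V →ₗ[ℝ] V →ₗ[ℝ] ℝ} {ε : ι → ℝ} {e : ι → V} {η : κ → ℝ} {f : κ → V}
    (he : IsPseudoOrthonormal B ε e) (hε : ∀ i, ε i = 1 ∨ ε i = -1)
    (hf : IsPseudoOrthonormal B η f) (hη : ∀ i, η i = 1 ∨ η i = -1)
    (hB : ∀ x y, B x y = B y x)
    (hperp : ∀ x : V, x ∈ Submodule.span ℝ (Set.range f) ↔
      ∀ y ∈ Submodule.span ℝ (Set.range e), B x y = 0) (v : V) :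
    v = ∑ s : ι ⊕ κ, (Sum.elim ε η s * B v (Sum.elim e f s)) • Sum.elim e f s := by
  have hfe : ∀ i j, B (e i) (f j) = 0 := fun i j => by
    rw [hB]
    exact (hperp _).mp (Submodule.subset_span ⟨j, rfl⟩) _ (Submodule.subset_span ⟨i, rfl⟩)
  have hmem : v - ∑ i, (ε i * B v (e i)) • e i ∈ Submodule.span ℝ (Set.range f) := by
    refine (hperp _).mpr fun y hy => ?_
    rw [he.eq_sum_of_mem_span hε hy]
    simp only [map_sum, map_smul, smul_eq_mul]
    refine Finset.sum_eq_zero fun k _ => ?_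
    simp [map_sum, he _ _]
    right
    linear_combination (-B v (e k)) * mul_self_eq_one_of_sign hε k
  have h := hf.eq_sum_of_mem_span hη hmem
  simp [map_sum, hfe] at h
  simp only [Fintype.sum_sum_type, Sum.elim_inl, Sum.elim_inr]
  rw [← h]
  abel

end PseudoOrthonormal


/-- Theorem 1.1, pseudo-Riemannian: let B have signature (p,q) realized
by a pseudo-orthonormal basis u with signs ζ, and let (r₀,s₀) be admissible.  If
J(π)∘J(π^⊥) = J(π^⊥)∘J(π) for every nondegenerate subspace π of signature (r₀,s₀),
then ρ∘J(v) = J(v)∘ρ for every v, and consequently ρ∘J(π) = J(π)∘ρ and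
J(π)∘J(π^⊥) = J(π^⊥)∘J(π) for every nondegenerate subspace π (given via a
pseudo-orthonormal basis e of π and a pseudo-orthonormal basis f of π^⊥). -/
theorem stmt_17 {V : Type*} [AddCommGroup V] [Module ℝ V] [FiniteDimensional ℝ V]
    (B : V →ₗ[ℝ] V →ₗ[ℝ] ℝ)
    (hBsymm : ∀ x y : V, B x y = B y x)
    (hBnd : ∀ x : V, (∀ y : V, B x y = 0) → x = 0)
    (A : V →ₗ[ℝ] V →ₗ[ℝ] V →ₗ[ℝ] V →ₗ[ℝ] ℝ)
    (hA1 : ∀ v₁ v₂ v₃ v₄ : V, A v₁ v₂ v₃ v₄ = A v₃ v₄ v₁ v₂)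
    (hA2 : ∀ v₁ v₂ v₃ v₄ : V, A v₁ v₂ v₃ v₄ = - A v₂ v₁ v₃ v₄)
    (hA3 : ∀ v₁ v₂ v₃ v₄ : V, A v₁ v₂ v₃ v₄ + A v₂ v₃ v₁ v₄ + A v₃ v₁ v₂ v₄ = 0)
    (J : V → V →ₗ[ℝ] V)
    (hJ : ∀ v x y : V, B (J v x) y = A x v v y)
    (m p q r₀ s₀ : ℕ) (hm : m = Module.finrank ℝ V)
    (u : Fin m → V) (ζ : Fin m → ℝ) (hζ : ∀ i, ζ i = 1 ∨ ζ i = -1)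
    (hu_span : Submodule.span ℝ (Set.range u) = ⊤)
    (hu : ∀ i j, B (u i) (u j) = if i = j then ζ i else 0)
    (hp : (Finset.univ.filter fun i => ζ i = 1).card = p)
    (hq : (Finset.univ.filter fun i => ζ i = -1).card = q)
    (hr₀ : r₀ ≤ p) (hs₀ : s₀ ≤ q) (hrs₁ : 1 ≤ r₀ + s₀) (hrs₂ : r₀ + s₀ ≤ m - 1)
    (hcomm : ∀ (e : Fin (r₀ + s₀) → V) (ε : Fin (r₀ + s₀) → ℝ),
        (∀ i, ε i = 1 ∨ ε i = -1) →
        (∀ i j, B (e i) (e j) = if i = j then ε i else 0) →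
        (Finset.univ.filter fun i => ε i = 1).card = r₀ →
        (Finset.univ.filter fun i => ε i = -1).card = s₀ →
        ∀ (l : ℕ) (f : Fin l → V) (η : Fin l → ℝ),
          (∀ i, η i = 1 ∨ η i = -1) →
          (∀ i j, B (f i) (f j) = if i = j then η i else 0) →
          (∀ x : V, x ∈ Submodule.span ℝ (Set.range f) ↔
              ∀ y ∈ Submodule.span ℝ (Set.range e), B x y = 0) →
          (∑ i, ε i • J (e i)) ∘ₗ (∑ i, η i • J (f i)) =
            (∑ i, η i • J (f i)) ∘ₗ (∑ i, ε i • J (e i))) :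
    (∀ v : V, (∑ i, ζ i • J (u i)) ∘ₗ J v = J v ∘ₗ (∑ i, ζ i • J (u i))) ∧
    (∀ (k : ℕ) (e : Fin k → V) (ε : Fin k → ℝ),
        (∀ i, ε i = 1 ∨ ε i = -1) →
        (∀ i j, B (e i) (e j) = if i = j then ε i else 0) →
        ∀ (l : ℕ) (f : Fin l → V) (η : Fin l → ℝ),
          (∀ i, η i = 1 ∨ η i = -1) →
          (∀ i j, B (f i) (f j) = if i = j then η i else 0) →
          (∀ x : V, x ∈ Submodule.span ℝ (Set.range f) ↔
              ∀ y ∈ Submodule.span ℝ (Set.range e), B x y = 0) →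
          (∑ i, ζ i • J (u i)) ∘ₗ (∑ i, ε i • J (e i)) =
              (∑ i, ε i • J (e i)) ∘ₗ (∑ i, ζ i • J (u i)) ∧
            (∑ i, ε i • J (e i)) ∘ₗ (∑ i, η i • J (f i)) =
              (∑ i, η i • J (f i)) ∘ₗ (∑ i, ε i • J (e i))) := by
  have hswap : ∀ v x y, A x v v y = A y v v x := by
    intro v x y
    rw [hA1, hA2, hA1 y v v x, hA2 v x y v, hA1 x v y v]
  have hext : ∀ S T : V →ₗ[ℝ] V, (∀ x y, B (S x) y = B (T x) y) → S = T := by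
    intro S T h
    ext x
    rw [← sub_eq_zero]
    refine hBnd _ fun y => ?_
    simp [h x y]
  have hBsum : ∀ {n : ℕ} (e : Fin n → V) (ε : Fin n → ℝ) (x y : V),
      B ((∑ i, ε i • J (e i)) x) y = ∑ i, ε i * A x (e i) (e i) y := by
    intro n e ε x y
    simp [LinearMap.sum_apply, map_sum, hJ]
  have huO : IsPseudoOrthonormal B ζ u := hu
  have hspan : ∀ w : Fin m → V, IsPseudoOrthonormal B ζ w →
      Submodule.span ℝ (Set.range w) = ⊤ := fun w hw =>
    (hw.linearIndependent hζ).span_eq_top_of_card_eq_finrank' (by simpa using hm)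
  have hexp : ∀ w : Fin m → V, IsPseudoOrthonormal B ζ w →
      ∀ v, v = ∑ i, (ζ i * B v (w i)) • w i := fun w hw v =>
    hw.eq_sum_of_mem_span hζ (by rw [hspan w hw]; trivial)
  set ρ := ∑ i, ζ i • J (u i) with hρ
  have hsplit : ∀ (k : ℕ) (e : Fin k → V) (ε : Fin k → ℝ),
      (∀ i, ε i = 1 ∨ ε i = -1) → IsPseudoOrthonormal B ε e →
      ∀ (l : ℕ) (f : Fin l → V) (η : Fin l → ℝ),
        (∀ i, η i = 1 ∨ η i = -1) → IsPseudoOrthonormal B η f →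
        (∀ x : V, x ∈ Submodule.span ℝ (Set.range f) ↔
            ∀ y ∈ Submodule.span ℝ (Set.range e), B x y = 0) →
        ∑ i, η i • J (f i) = ρ - ∑ i, ε i • J (e i) := by
    intro k e ε hε he l f η hη hf hperp
    rw [eq_sub_iff_add_eq']
    refine hext _ _ fun x y => ?_
    have h := sum_sign_mul_apply_self_eq hBsymm
      (eq_sum_elim_of_span_eq_orthogonal he hε hf hη hBsymm hperp) (hexp u huO)
      ((A x).compr₂ (LinearMap.applyₗ y))
    simp only [Fintype.sum_sum_type, Sum.elim_inl, Sum.elim_inr, LinearMap.compr₂_apply,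
      LinearMap.applyₗ_apply_apply] at h
    rw [LinearMap.add_apply, map_add, LinearMap.add_apply, hBsum, hBsum, hρ, hBsum, h]
  have hρself : ∀ x y, B (ρ x) y = B x (ρ y) := by
    intro x y
    rw [hBsymm x, hρ, hBsum, hBsum]
    exact Finset.sum_congr rfl fun i _ => by rw [hswap]
  obtain ⟨S₁, hS₁, hS₁c⟩ := Finset.exists_subset_card_eq (hp.symm ▸ hr₀)
  obtain ⟨S₂, hS₂, hS₂c⟩ := Finset.exists_subset_card_eq (hq.symm ▸ hs₀)
  have hS₁ζ : ∀ i ∈ S₁, ζ i = 1 := fun i hi => by simpa using hS₁ hi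
  have hS₂ζ : ∀ i ∈ S₂, ζ i = -1 := fun i hi => by simpa using hS₂ hi
  have hdisj : Disjoint S₁ S₂ := Finset.disjoint_left.mpr fun i h1 h2 => by
    have := (hS₁ζ i h1).symm.trans (hS₂ζ i h2)
    norm_num at this
  set S := S₁ ∪ S₂ with hSdef
  have hScard : S.card = r₀ + s₀ := by rw [hSdef, Finset.card_union_of_disjoint hdisj, hS₁c, hS₂c]
  have hSpos : S.filter (fun i => ζ i = 1) = S₁ := by
    ext i
    simp only [hSdef, Finset.mem_filter, Finset.mem_union]
    refine ⟨?_, fun h => ⟨Or.inl h, hS₁ζ i h⟩⟩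
    rintro ⟨h | h, h'⟩
    · exact h
    · have := h'.symm.trans (hS₂ζ i h)
      norm_num at this
  have hSneg : S.filter (fun i => ζ i = -1) = S₂ := by
    ext i
    simp only [hSdef, Finset.mem_filter, Finset.mem_union]
    refine ⟨?_, fun h => ⟨Or.inr h, hS₂ζ i h⟩⟩
    rintro ⟨h | h, h'⟩
    · have := h'.symm.trans (hS₁ζ i h)
      norm_num at this
    · exact h
  have hSne : S.Nonempty := Finset.card_pos.mp (by omega)
  have hSproper : ∃ j, j ∉ S := by
    by_contra! h
    have : S.card = m := by rw [Finset.eq_univ_of_forall h]; simp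
    omega
  have hpartial : ∀ w : Fin m → V, IsPseudoOrthonormal B ζ w →
      (∑ i ∈ S, ζ i • J (w i)) ∘ₗ ρ = ρ ∘ₗ (∑ i ∈ S, ζ i • J (w i)) := by
    intro w hw
    let g := S.orderEmbOfFin hScard
    let g' := Sᶜ.orderEmbOfFin rfl
    have hgmap : Finset.univ.map g.toEmbedding = S := by simp [g]
    have hg : ∀ i, g i ∈ S := S.orderEmbOfFin_mem hScard
    have hg' : ∀ i, g' i ∉ S := fun i => Finset.mem_compl.mp (Sᶜ.orderEmbOfFin_mem rfl i)
    have hg'surj : ∀ j ∉ S, ∃ i, g' i = j := fun j hj => by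
      have : j ∈ Set.range g' := by simpa [g', Finset.range_orderEmbOfFin] using hj
      exact this
    have hcount : ∀ c : ℝ, (Finset.univ.filter fun i => ζ (g i) = c).card =
        (S.filter fun i => ζ i = c).card := by
      intro c
      conv_rhs => rw [← hgmap, Finset.filter_map, Finset.card_map]
      rfl
    have he : IsPseudoOrthonormal B (ζ ∘ g) (w ∘ g) := fun i j => by
      simp [hw _ _]
    have hf : IsPseudoOrthonormal B (ζ ∘ g') (w ∘ g') := fun i j => by
      simp [hw _ _]
    have hperp : ∀ x : V, x ∈ Submodule.span ℝ (Set.range (w ∘ g')) ↔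
        ∀ y ∈ Submodule.span ℝ (Set.range (w ∘ g)), B x y = 0 := by
      intro x
      constructor
      · intro hx y hy
        obtain ⟨c, rfl⟩ := (Submodule.mem_span_range_iff_exists_fun ℝ).mp hx
        obtain ⟨d, rfl⟩ := (Submodule.mem_span_range_iff_exists_fun ℝ).mp hy
        have : ∀ i j, g' i ≠ g j := fun i j h => hg' i (h ▸ hg j)
        simp [map_sum, hw _ _, this]
      · intro hx
        rw [hexp w hw x]
        refine Submodule.sum_mem _ fun i _ => ?_
        by_cases hi : i ∈ S
        · rw [← hgmap] at hi
          obtain ⟨j, -, rfl⟩ := Finset.mem_map.mp hi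
          have := hx (w (g j)) (Submodule.subset_span ⟨j, rfl⟩)
          simp [this]
        · obtain ⟨j, rfl⟩ := hg'surj i hi
          exact Submodule.smul_mem _ _ (Submodule.subset_span ⟨j, rfl⟩)
    have h := hcomm (w ∘ g) (ζ ∘ g) (fun i => hζ _) he
      ((hcount 1).trans (by rw [hSpos, hS₁c])) ((hcount (-1)).trans (by rw [hSneg, hS₂c]))
      _ (w ∘ g') (ζ ∘ g') (fun i => hζ _) hf hperp
    rw [hsplit _ (w ∘ g) (ζ ∘ g) (fun i => hζ _) he _ (w ∘ g') (ζ ∘ g') (fun i => hζ _) hf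
      hperp] at h
    have hsum : ∑ i, (ζ ∘ g) i • J ((w ∘ g) i) = ∑ i ∈ S, ζ i • J (w i) := by
      conv_rhs => rw [← hgmap, Finset.sum_map]
      rfl
    rw [hsum, LinearMap.comp_sub, LinearMap.sub_comp] at h
    exact sub_left_injective h
  have hmain : ∀ v, ρ ∘ₗ J v = J v ∘ₗ ρ := by
    intro v
    refine hext _ _ fun x y => ?_
    have h := alternating_of_sum_eq_zero (B := B)
      (b := (A x).compr₂ (LinearMap.applyₗ (ρ y)) - (A (ρ x)).compr₂ (LinearMap.applyₗ y))
      hζ hSne hSproper (fun w hw => ?_) huO hu_span v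
    · simp only [LinearMap.sub_apply, LinearMap.compr₂_apply,
        LinearMap.applyₗ_apply_apply] at h
      rw [LinearMap.comp_apply, LinearMap.comp_apply, hρself, hJ, hJ]
      linarith
    · have h := congrArg (fun T : V →ₗ[ℝ] V => B (T x) y) (hpartial w hw)
      simp only [LinearMap.comp_apply, hρself] at h
      simp only [LinearMap.sum_apply, LinearMap.smul_apply, map_sum, map_smul, hJ,
        smul_eq_mul] at h
      simp only [LinearMap.sub_apply, LinearMap.compr₂_apply,
        LinearMap.applyₗ_apply_apply, mul_sub, Finset.sum_sub_distrib]
      linarith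
  refine ⟨hmain, fun k e ε hε he l f η hη hf hperp => ?_⟩
  have hρe : ρ ∘ₗ (∑ i, ε i • J (e i)) = (∑ i, ε i • J (e i)) ∘ₗ ρ := by
    ext x
    simp only [LinearMap.comp_apply, LinearMap.sum_apply, LinearMap.smul_apply, map_sum, map_smul]
    exact Finset.sum_congr rfl fun i _ => congrArg (ε i • ·) (LinearMap.congr_fun (hmain (e i)) x)
  refine ⟨hρe, ?_⟩
  rw [hsplit k e ε hε he l f η hη hf hperp, LinearMap.comp_sub, LinearMap.sub_comp, hρe]
end

section
/- Suppose ρ∘J(v) = J(v)∘ρ for every v ∈ V. Let λ₁, λ₂, λ₃, λ₄ be real numbers and let xᵢ lie in the generalized eigenspace of ρ for λᵢ (i = 1,2,3,4). If λ₁ ≠ λ₄, then A(x₁,x₂,x₃,x₄) = −A(x₁,x₃,x₂,x₄). -/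
open Polynomial in
/-- Generalized eigenspaces of a self-adjoint operator for distinct eigenvalues are orthogonal. -/
theorem apply_eq_zero_of_mem_ker_pow_of_ne {K V : Type*} [Field K] [AddCommGroup V] [Module K V]
    (B : V →ₗ[K] V →ₗ[K] K) (f : Module.End K V) (hf : ∀ x y, B (f x) y = B x (f y))
    {a b : K} (hab : a ≠ b) {n : ℕ} {x y : V}
    (hx : x ∈ LinearMap.ker ((f - a • LinearMap.id) ^ n))
    (hy : y ∈ LinearMap.ker ((f - b • LinearMap.id) ^ n)) : B x y = 0 := by
  have aeval_sub (c : K) : aeval f ((X - C c) ^ n) = (f - c • LinearMap.id) ^ n := by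
    rw [map_pow, map_sub, aeval_X, aeval_C, Algebra.algebraMap_eq_smul_one]
    rfl
  have adjoint_pow : ∀ (k : ℕ) (v w : V), B (((f - b • LinearMap.id : Module.End K V) ^ k) v) w =
      B v (((f - b • LinearMap.id : Module.End K V) ^ k) w) := by
    intro k
    induction k with
    | zero => intro v w; rfl
    | succ k ih =>
      intro v w
      rw [pow_succ, Module.End.mul_apply, ih, ← pow_succ, pow_succ', Module.End.mul_apply]
      simp [hf]
  obtain ⟨p, q, hpq⟩ : IsCoprime ((X - C a) ^ n) ((X - C b) ^ n) :=
    (isCoprime_X_sub_C_of_isUnit_sub (sub_ne_zero.mpr hab).isUnit).pow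
  have hpq' := congrArg (fun r => aeval f r x) hpq
  rw [mul_comm q] at hpq'
  simp only [map_add, map_mul, aeval_sub, map_one, LinearMap.add_apply, Module.End.mul_apply,
    LinearMap.mem_ker.mp hx, map_zero, zero_add, Module.End.one_apply] at hpq'
  rw [← hpq', adjoint_pow, LinearMap.mem_ker.mp hy, map_zero]

/-- pseudo-Riemannian: if ρ commutes with every Jacobi operator and
xᵢ lies in the generalized eigenspace of ρ for λᵢ, then λ₁ ≠ λ₄ implies
A(x₁,x₂,x₃,x₄) = −A(x₁,x₃,x₂,x₄). -/
theorem stmt_18 {V : Type*} [AddCommGroup V] [Module ℝ V] [FiniteDimensional ℝ V]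
    (B : V →ₗ[ℝ] V →ₗ[ℝ] ℝ)
    (hBsymm : ∀ x y : V, B x y = B y x)
    (hBnd : ∀ x : V, (∀ y : V, B x y = 0) → x = 0)
    (A : V →ₗ[ℝ] V →ₗ[ℝ] V →ₗ[ℝ] V →ₗ[ℝ] ℝ)
    (hA1 : ∀ v₁ v₂ v₃ v₄ : V, A v₁ v₂ v₃ v₄ = A v₃ v₄ v₁ v₂)
    (hA2 : ∀ v₁ v₂ v₃ v₄ : V, A v₁ v₂ v₃ v₄ = - A v₂ v₁ v₃ v₄)
    (hA3 : ∀ v₁ v₂ v₃ v₄ : V, A v₁ v₂ v₃ v₄ + A v₂ v₃ v₁ v₄ + A v₃ v₁ v₂ v₄ = 0)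
    (J : V → V →ₗ[ℝ] V)
    (hJ : ∀ v x y : V, B (J v x) y = A x v v y)
    (m : ℕ) (hm : m = Module.finrank ℝ V)
    (u : Fin m → V) (ζ : Fin m → ℝ) (hζ : ∀ i, ζ i = 1 ∨ ζ i = -1)
    (hu_span : Submodule.span ℝ (Set.range u) = ⊤)
    (hu : ∀ i j, B (u i) (u j) = if i = j then ζ i else 0)
    (ρ : V →ₗ[ℝ] V) (hρ : ρ = ∑ i, ζ i • J (u i))
    (hcomm : ∀ v : V, ρ ∘ₗ J v = J v ∘ₗ ρ)
    (μ₁ μ₂ μ₃ μ₄ : ℝ) (x₁ x₂ x₃ x₄ : V)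
    (hx₁ : x₁ ∈ LinearMap.ker ((ρ - μ₁ • LinearMap.id) ^ Module.finrank ℝ V))
    (hx₂ : x₂ ∈ LinearMap.ker ((ρ - μ₂ • LinearMap.id) ^ Module.finrank ℝ V))
    (hx₃ : x₃ ∈ LinearMap.ker ((ρ - μ₃ • LinearMap.id) ^ Module.finrank ℝ V))
    (hx₄ : x₄ ∈ LinearMap.ker ((ρ - μ₄ • LinearMap.id) ^ Module.finrank ℝ V))
    (hne : μ₁ ≠ μ₄) :
    A x₁ x₂ x₃ x₄ = - A x₁ x₃ x₂ x₄ := by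
  have hJ_adj (v x y : V) : B (J v x) y = B x (J v y) := by
    rw [hBsymm x, hJ, hJ]
    linarith [hA1 x v v y, hA2 v y x v, hA1 y v x v, hA2 x v y v, hA1 v x y v]
  have hρ_adj (x y : V) : B (ρ x) y = B x (ρ y) := by
    simp [hρ, LinearMap.sum_apply, map_sum, hJ_adj]
  set K := J (x₂ + x₃) - J x₂ - J x₃ with hK
  have hKρ : Commute K ρ := by
    have hJρ (v : V) : Commute (J v) ρ := (hcomm v).symm
    exact ((hJρ _).sub_left (hJρ _)).sub_left (hJρ _)
  have hKx₁ : K x₁ ∈ LinearMap.ker ((ρ - μ₁ • LinearMap.id) ^ Module.finrank ℝ V) := by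
    have hc : Commute K ((ρ - μ₁ • LinearMap.id) ^ Module.finrank ℝ V) :=
      (hKρ.sub_right ((Commute.one_right K).smul_right μ₁)).pow_right _
    rw [LinearMap.mem_ker, ← Module.End.mul_apply, ← hc.eq, Module.End.mul_apply,
      LinearMap.mem_ker.mp hx₁, map_zero]
  have hzero := apply_eq_zero_of_mem_ker_pow_of_ne B ρ hρ_adj hne hKx₁ hx₄
  simp only [hK, LinearMap.sub_apply, map_sub, hJ, map_add, LinearMap.add_apply] at hzero
  linarith
end
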